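/- Let C be a locally presentable category with a cofibrantly generated weak factorization system (L, R) such that ∅ → X lies in L for every object X, equipped with an exact cylinder I and a class An(I) of right I-anodyne extensions. Then there exists a unique model category structure on C in which: (1) the class of cofibrations is exactly L; (2) a morphism f : A → B is a weak equivalence if and only if for every right I-fibrant object W the induced map f* : [B, W]_I → [A, W]_I is bijective. Moreover, in this model structure an object is fibrant if and only if it is right I-fibrant, and a morphism between right I-fibrant objects is a fibration if and only if it is a right I-fibration. -/

import Mathlib

set_option linter.unusedSectionVars false

open CategoryTheory CategoryTheory.Limits

universe v u

namespace Paper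

variable {C : Type u} [Category.{v} C]

/-- The class of morphisms having the left lifting property against every morphism in `T`. -/
def llp (T : MorphismProperty C) : MorphismProperty C :=
  fun _ _ f => ∀ ⦃X Y : C⦄ (g : X ⟶ Y), T g → HasLiftingProperty f g

/-- The class of morphisms having the right lifting property against every morphism in `T`. -/
def rlp (T : MorphismProperty C) : MorphismProperty C :=
  fun _ _ g => ∀ ⦃A B : C⦄ (f : A ⟶ B), T f → HasLiftingProperty f g

/-- The morphism property associated to a set of arrows. -/
def ofArrows (S : Set (Arrow C)) : MorphismProperty C :=
  fun _ _ f => Arrow.mk f ∈ S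

/-- A (possibly large) category `J` is `κ`-filtered if every diagram in `J` indexed by a
small category of size `< κ` admits a cocone. -/
def IsCardinalFiltered (J : Cat.{v, v}) (κ : Cardinal.{v}) : Prop :=
  ∀ K : Cat.{v, v}, Cardinal.mk (Arrow K) < κ → ∀ F : K ⥤ J, Nonempty (Cocone F)

/-- An object `X` is `κ`-presentable if `Hom(X, -)` preserves colimits of `κ`-filtered
diagrams. -/
def IsPresentableObj (κ : Cardinal.{v}) (X : C) : Prop :=
  ∀ J : Cat.{v, v}, IsCardinalFiltered J κ →
    PreservesColimitsOfShape J (coyoneda.obj (Opposite.op X))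

/-- A category is locally presentable if it is cocomplete and there is a regular cardinal `κ`
and a small family of `κ`-presentable objects such that every object is a `κ`-filtered colimit
of objects of the family. -/
class LocallyPresentable (C : Type u) [Category.{v} C] extends HasColimits C : Prop where
  exists_presentable_generator :
    ∃ κ : Cardinal.{v}, κ.IsRegular ∧
      ∃ (ι : Type v) (G : ι → C), (∀ i, IsPresentableObj κ (G i)) ∧
        ∀ X : C, ∃ (J : Cat.{v, v}) (F : J ⥤ C) (c : Cocone F),
          IsCardinalFiltered J κ ∧ Nonempty (IsColimit c) ∧
          (∀ j : J, ∃ i, Nonempty (F.obj j ≅ G i)) ∧ Nonempty (c.pt ≅ X)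

/-- `(L, R)` is a cofibrantly generated weak factorization system such that every morphism
from the initial object is in `L`. -/
structure IsCofGenWFS [HasColimits C] (L R : MorphismProperty C) : Prop where
  exists_generating_set : ∃ S : Set (Arrow C), Small.{v} S ∧ L = llp (rlp (ofArrows S))
  rlp_eq : R = rlp L
  factorization : ∀ ⦃X Y : C⦄ (f : X ⟶ Y),
    ∃ (Z : C) (i : X ⟶ Z) (p : Z ⟶ Y), L i ∧ R p ∧ i ≫ p = f
  initial_mem : ∀ X : C, L (initial.to X)

/-- A functorial cylinder on `C`. -/
structure Cylinder (C : Type u) [Category.{v} C] where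
  I : C ⥤ C
  d0 : 𝟭 C ⟶ I
  d1 : 𝟭 C ⟶ I
  σ : I ⟶ 𝟭 C
  d0_σ : ∀ X : C, d0.app X ≫ σ.app X = 𝟙 X
  d1_σ : ∀ X : C, d1.app X ≫ σ.app X = 𝟙 X

namespace Cylinder

variable (E : Cylinder C)

lemma d0_naturality' {K M : C} (f : K ⟶ M) :
    f ≫ E.d0.app M = E.d0.app K ≫ E.I.map f := by
  simpa using E.d0.naturality f

lemma d1_naturality' {K M : C} (f : K ⟶ M) :
    f ≫ E.d1.app M = E.d1.app K ≫ E.I.map f := by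
  simpa using E.d1.naturality f

variable [HasColimits C]

/-- The canonical map `X ⊔ X ⟶ I(X)`. -/
noncomputable def ι (X : C) : X ⨿ X ⟶ E.I.obj X :=
  coprod.desc (E.d0.app X) (E.d1.app X)

lemma ι_naturality {K M : C} (f : K ⟶ M) :
    coprod.map f f ≫ E.ι M = E.ι K ≫ E.I.map f := by
  have h0 := E.d0.naturality f
  have h1 := E.d1.naturality f
  simp only [Functor.id_map] at h0 h1
  apply coprod.hom_ext <;> simp [ι, h0, h1]

/-- The pushout-corner map `∂I ⊠ f : (M ⊔ M) ⊔_{K ⊔ K} I(K) ⟶ I(M)`. -/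
noncomputable def boundaryBox {K M : C} (f : K ⟶ M) :
    pushout (coprod.map f f) (E.ι K) ⟶ E.I.obj M :=
  pushout.desc (E.ι M) (E.I.map f) (E.ι_naturality f)

/-- The pushout-corner map `∂0 ⊠ f : M ⊔_K I(K) ⟶ I(M)`. -/
noncomputable def box0 {K M : C} (f : K ⟶ M) :
    pushout f (E.d0.app K) ⟶ E.I.obj M :=
  pushout.desc (E.d0.app M) (E.I.map f) (E.d0_naturality' f)

/-- The pushout-corner map `∂1 ⊠ f : M ⊔_K I(K) ⟶ I(M)`. -/
noncomputable def box1 {K M : C} (f : K ⟶ M) :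
    pushout f (E.d1.app K) ⟶ E.I.obj M :=
  pushout.desc (E.d1.app M) (E.I.map f) (E.d1_naturality' f)

end Cylinder

/-- A cylinder is exact with respect to the class `L` if it preserves small colimits,
the maps `X ⊔ X ⟶ I(X)` are in `L`, and the pushout-corner maps of morphisms of `L` are
again in `L`. -/
structure IsExactCylinder [HasColimits C] (E : Cylinder C) (L : MorphismProperty C) : Prop where
  preservesColimits : PreservesColimits E.I
  ι_mem : ∀ X : C, L (E.ι X)
  boundaryBox_mem : ∀ ⦃K M : C⦄ (f : K ⟶ M), L f → L (E.boundaryBox f)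
  box0_mem : ∀ ⦃K M : C⦄ (f : K ⟶ M), L f → L (E.box0 f)
  box1_mem : ∀ ⦃K M : C⦄ (f : K ⟶ M), L f → L (E.box1 f)

/-- `An` is a class of right `I`-anodyne extensions. -/
structure IsRightAnodyneClass [HasColimits C] (E : Cylinder C) (L : MorphismProperty C)
    (An : MorphismProperty C) : Prop where
  le : An ≤ L
  exists_generating_set : ∃ Λ : Set (Arrow C), Small.{v} Λ ∧ ofArrows Λ ≤ L ∧
    An = llp (rlp (ofArrows Λ))
  box1_mem : ∀ ⦃K M : C⦄ (f : K ⟶ M), L f → An (E.box1 f)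
  boundaryBox_mem : ∀ ⦃K M : C⦄ (f : K ⟶ M), An f → An (E.boundaryBox f)

/-- `An` is a class of left `I`-anodyne extensions. -/
structure IsLeftAnodyneClass [HasColimits C] (E : Cylinder C) (L : MorphismProperty C)
    (An : MorphismProperty C) : Prop where
  le : An ≤ L
  exists_generating_set : ∃ Λ : Set (Arrow C), Small.{v} Λ ∧ ofArrows Λ ≤ L ∧
    An = llp (rlp (ofArrows Λ))
  box0_mem : ∀ ⦃K M : C⦄ (f : K ⟶ M), L f → An (E.box0 f)
  boundaryBox_mem : ∀ ⦃K M : C⦄ (f : K ⟶ M), An f → An (E.boundaryBox f)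

/-- A morphism is an `An`-fibration if it has the right lifting property against all
morphisms of `An`. -/
def IsFib (An : MorphismProperty C) {X Y : C} (p : X ⟶ Y) : Prop :=
  ∀ ⦃A B : C⦄ (f : A ⟶ B), An f → HasLiftingProperty f p

/-- An object `W` is `An`-fibrant if the map `W ⟶ *` has the right lifting property against
all morphisms of `An`, i.e. every morphism to `W` extends along every morphism of `An`. -/
def IsFibrantObj (An : MorphismProperty C) (W : C) : Prop :=
  ∀ ⦃A B : C⦄ (f : A ⟶ B), An f → ∀ a : A ⟶ W, ∃ b : B ⟶ W, f ≫ b = a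

namespace Cylinder

variable (E : Cylinder C)

/-- An `I`-homotopy from `f` to `g`. -/
def Homotopy {X Y : C} (f g : X ⟶ Y) : Prop :=
  ∃ h : E.I.obj X ⟶ Y, E.d0.app X ≫ h = f ∧ E.d1.app X ≫ h = g

/-- `[X, Y]_I`, the quotient of `Hom(X, Y)` by the equivalence relation generated by
`I`-homotopy. -/
def HoHom (X Y : C) : Type v :=
  Quot (fun f g : X ⟶ Y => E.Homotopy f g)

/-- Precomposition `f^* : [B, W]_I ⟶ [A, W]_I`. -/
def precompQ {A B : C} (f : A ⟶ B) (W : C) : E.HoHom B W → E.HoHom A W :=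
  Quot.lift (fun g => Quot.mk _ (f ≫ g)) (by
    rintro g g' ⟨h, h0, h1⟩
    apply Quot.sound
    refine ⟨E.I.map f ≫ h, ?_, ?_⟩
    · rw [← Category.assoc, ← E.d0_naturality' f, Category.assoc, h0]
    · rw [← Category.assoc, ← E.d1_naturality' f, Category.assoc, h1])

end Cylinder

/-- `f` is a weak equivalence if it induces bijections `[B, W]_I ≅ [A, W]_I` for all
fibrant `W`. -/
def IsWeakEq (E : Cylinder C) (An : MorphismProperty C) {A B : C} (f : A ⟶ B) : Prop :=
  ∀ W : C, IsFibrantObj An W → Function.Bijective (E.precompQ f W)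

/-- `f` is a retract of `f'`. -/
def IsRetractOf {X Y X' Y' : C} (f : X ⟶ Y) (f' : X' ⟶ Y') : Prop :=
  ∃ (i : X ⟶ X') (r : X' ⟶ X) (j : Y ⟶ Y') (s : Y' ⟶ Y),
    i ≫ r = 𝟙 X ∧ j ≫ s = 𝟙 Y ∧ i ≫ f' = f ≫ j ∧ f' ≫ s = r ≫ f

/-- A model structure on a category: the classes of weak equivalences, cofibrations and
fibrations, subject to the two-out-of-three, retract, lifting and factorization axioms. -/
structure ModelStructure (C : Type u) [Category.{v} C] where
  weq : MorphismProperty C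
  cof : MorphismProperty C
  fib : MorphismProperty C
  weq_id : ∀ X : C, weq (𝟙 X)
  weq_comp : ∀ ⦃X Y Z : C⦄ (f : X ⟶ Y) (g : Y ⟶ Z), weq f → weq g → weq (f ≫ g)
  weq_cancel_left : ∀ ⦃X Y Z : C⦄ (f : X ⟶ Y) (g : Y ⟶ Z), weq f → weq (f ≫ g) → weq g
  weq_cancel_right : ∀ ⦃X Y Z : C⦄ (f : X ⟶ Y) (g : Y ⟶ Z), weq g → weq (f ≫ g) → weq f
  weq_retract : ∀ ⦃X Y X' Y' : C⦄ (f : X ⟶ Y) (f' : X' ⟶ Y'),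
    IsRetractOf f f' → weq f' → weq f
  cof_retract : ∀ ⦃X Y X' Y' : C⦄ (f : X ⟶ Y) (f' : X' ⟶ Y'),
    IsRetractOf f f' → cof f' → cof f
  fib_retract : ∀ ⦃X Y X' Y' : C⦄ (f : X ⟶ Y) (f' : X' ⟶ Y'),
    IsRetractOf f f' → fib f' → fib f
  lift_trivCof_fib : ∀ ⦃A B X Y : C⦄ (i : A ⟶ B) (p : X ⟶ Y),
    cof i → weq i → fib p → HasLiftingProperty i p
  lift_cof_trivFib : ∀ ⦃A B X Y : C⦄ (i : A ⟶ B) (p : X ⟶ Y),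
    cof i → fib p → weq p → HasLiftingProperty i p
  fact_cof_trivFib : ∀ ⦃X Y : C⦄ (f : X ⟶ Y),
    ∃ (Z : C) (i : X ⟶ Z) (p : Z ⟶ Y), cof i ∧ fib p ∧ weq p ∧ i ≫ p = f
  fact_trivCof_fib : ∀ ⦃X Y : C⦄ (f : X ⟶ Y),
    ∃ (Z : C) (i : X ⟶ Z) (p : Z ⟶ Y), cof i ∧ weq i ∧ fib p ∧ i ≫ p = f

/-- An object `W` is fibrant for a model structure if every morphism to `W` extends along
every trivial cofibration, i.e. `W ⟶ *` has the right lifting property against trivial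
cofibrations. -/
def ModelStructure.Fibrant (M : ModelStructure C) (W : C) : Prop :=
  ∀ ⦃A B : C⦄ (i : A ⟶ B), M.cof i → M.weq i → ∀ a : A ⟶ W, ∃ b : B ⟶ W, i ≫ b = a

/-! ### Lifting and extension along corner maps -/

lemma exists_lift_of_hasLiftingProperty {A B X Y : C} {i : A ⟶ B} {p : X ⟶ Y}
    (h : HasLiftingProperty i p) (f : A ⟶ X) (g : B ⟶ Y) (w : f ≫ p = i ≫ g) :
    ∃ l : B ⟶ X, i ≫ l = f ∧ l ≫ p = g := by
  have sq : CommSq f i p g := ⟨w⟩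
  exact ⟨sq.lift, sq.fac_left, sq.fac_right⟩

lemma hasLiftingProperty_of_exists_lift {A B X Y : C} {i : A ⟶ B} {p : X ⟶ Y}
    (h : ∀ (f : A ⟶ X) (g : B ⟶ Y), f ≫ p = i ≫ g → ∃ l : B ⟶ X, i ≫ l = f ∧ l ≫ p = g) :
    HasLiftingProperty i p where
  sq_hasLift {f g} sq := by
    obtain ⟨l, h₁, h₂⟩ := h f g sq.w
    exact ⟨⟨⟨l, h₁, h₂⟩⟩⟩

namespace Cylinder

variable (E : Cylinder C)

/-- The start of the cylinder. -/
def i0 (X : C) : X ⟶ E.I.obj X := E.d0.app X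

/-- The end of the cylinder. -/
def i1 (X : C) : X ⟶ E.I.obj X := E.d1.app X

/-- The projection of the cylinder. -/
def proj (X : C) : E.I.obj X ⟶ X := E.σ.app X

@[simp]
lemma i0_proj (X : C) : E.i0 X ≫ E.proj X = 𝟙 X := E.d0_σ X

@[simp]
lemma i0_proj_assoc {X Y : C} (f : X ⟶ Y) : E.i0 X ≫ E.proj X ≫ f = f := by
  rw [← Category.assoc, i0_proj, Category.id_comp]

@[simp]
lemma i1_proj (X : C) : E.i1 X ≫ E.proj X = 𝟙 X := E.d1_σ X

@[simp]
lemma i1_proj_assoc {X Y : C} (f : X ⟶ Y) : E.i1 X ≫ E.proj X ≫ f = f := by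
  rw [← Category.assoc, i1_proj, Category.id_comp]

lemma i0_naturality {K M : C} (f : K ⟶ M) : f ≫ E.i0 M = E.i0 K ≫ E.I.map f :=
  E.d0_naturality' f

lemma i0_naturality_assoc {K M Z : C} (f : K ⟶ M) (h : E.I.obj M ⟶ Z) :
    f ≫ E.i0 M ≫ h = E.i0 K ≫ E.I.map f ≫ h := by
  rw [← Category.assoc, i0_naturality, Category.assoc]

lemma i1_naturality {K M : C} (f : K ⟶ M) : f ≫ E.i1 M = E.i1 K ≫ E.I.map f :=
  E.d1_naturality' f

lemma i1_naturality_assoc {K M Z : C} (f : K ⟶ M) (h : E.I.obj M ⟶ Z) :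
    f ≫ E.i1 M ≫ h = E.i1 K ≫ E.I.map f ≫ h := by
  rw [← Category.assoc, i1_naturality, Category.assoc]

lemma homotopy_iff {X Y : C} {f g : X ⟶ Y} :
    E.Homotopy f g ↔ ∃ h : E.I.obj X ⟶ Y, E.i0 X ≫ h = f ∧ E.i1 X ≫ h = g :=
  Iff.rfl

lemma proj_naturality {K M : C} (f : K ⟶ M) : E.I.map f ≫ E.proj M = E.proj K ≫ f :=
  E.σ.naturality f

lemma Homotopy.refl {X Y : C} (f : X ⟶ Y) : E.Homotopy f f :=
  E.homotopy_iff.2 ⟨E.proj X ≫ f, by simp, by simp⟩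

variable {E} in
lemma Homotopy.precomp {X Y Z : C} {f g : Y ⟶ Z} (h : E.Homotopy f g) (k : X ⟶ Y) :
    E.Homotopy (k ≫ f) (k ≫ g) := by
  obtain ⟨H, rfl, rfl⟩ := E.homotopy_iff.1 h
  exact E.homotopy_iff.2 ⟨E.I.map k ≫ H, (E.i0_naturality_assoc _ _).symm,
    (E.i1_naturality_assoc _ _).symm⟩

variable {E} in
lemma Homotopy.postcomp {X Y Z : C} {f g : X ⟶ Y} (h : E.Homotopy f g) (k : Y ⟶ Z) :
    E.Homotopy (f ≫ k) (g ≫ k) := by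
  obtain ⟨H, rfl, rfl⟩ := E.homotopy_iff.1 h
  exact E.homotopy_iff.2 ⟨H ≫ k, by simp, by simp⟩

lemma precompQ_id (X W : C) : E.precompQ (𝟙 X) W = id := by
  funext q
  induction q using Quot.ind
  exact congrArg (Quot.mk _) (Category.id_comp _)

lemma precompQ_comp {X Y Z : C} (f : X ⟶ Y) (g : Y ⟶ Z) (W : C) :
    E.precompQ (f ≫ g) W = E.precompQ f W ∘ E.precompQ g W := by
  funext q
  induction q using Quot.ind
  exact congrArg (Quot.mk _) (Category.assoc _ _ _)

variable {E} in
lemma Homotopy.precompQ_eq {X Y : C} {f g : X ⟶ Y} (h : E.Homotopy f g) (W : C) :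
    E.precompQ f W = E.precompQ g W := by
  funext q
  induction q using Quot.ind
  exact Quot.sound (h.postcomp _)

variable [HasColimits C]

@[simp]
lemma inl_ι (X : C) : coprod.inl ≫ E.ι X = E.i0 X := coprod.inl_desc _ _

@[simp]
lemma inr_ι (X : C) : coprod.inr ≫ E.ι X = E.i1 X := coprod.inr_desc _ _

@[simp]
lemma inl_ι_assoc {X Y : C} (f : E.I.obj X ⟶ Y) : coprod.inl ≫ E.ι X ≫ f = E.i0 X ≫ f := by
  rw [← Category.assoc, inl_ι]

@[simp]
lemma inr_ι_assoc {X Y : C} (f : E.I.obj X ⟶ Y) : coprod.inr ≫ E.ι X ≫ f = E.i1 X ≫ f := by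
  rw [← Category.assoc, inr_ι]

/-- Maps out of `I (X ⨿ Y)` are given by pairs of maps when `I` preserves colimits. -/
lemma exists_desc_map_coprod [PreservesColimits E.I] {X Y W : C} (a : E.I.obj X ⟶ W)
    (b : E.I.obj Y ⟶ W) : ∃ h : E.I.obj (X ⨿ Y) ⟶ W,
      E.I.map coprod.inl ≫ h = a ∧ E.I.map coprod.inr ≫ h = b := by
  obtain ⟨l, h₁, h₂⟩ := BinaryCofan.IsColimit.desc'
    (isColimitOfHasBinaryCoproductOfPreservesColimit E.I X Y) a b
  exact ⟨l, h₁, h₂⟩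

lemma map_coprod_hom_ext [PreservesColimits E.I] {X Y W : C} {h k : E.I.obj (X ⨿ Y) ⟶ W}
    (h₁ : E.I.map coprod.inl ≫ h = E.I.map coprod.inl ≫ k)
    (h₂ : E.I.map coprod.inr ≫ h = E.I.map coprod.inr ≫ k) : h = k :=
  BinaryCofan.IsColimit.hom_ext
    (isColimitOfHasBinaryCoproductOfPreservesColimit E.I X Y) h₁ h₂

lemma exists_lift_box1 {K M X Y : C} {i : K ⟶ M} {p : X ⟶ Y}
    (H : HasLiftingProperty (E.box1 i) p) (c : M ⟶ X) (h : E.I.obj K ⟶ X) (b : E.I.obj M ⟶ Y)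
    (hc : i ≫ c = E.i1 K ≫ h) (hcb : c ≫ p = E.i1 M ≫ b)
    (hhb : h ≫ p = E.I.map i ≫ b) :
    ∃ k : E.I.obj M ⟶ X, E.i1 M ≫ k = c ∧ E.I.map i ≫ k = h ∧ k ≫ p = b := by
  replace H : HasLiftingProperty
      (pushout.desc (E.i1 M) (E.I.map i) (E.i1_naturality i) : pushout i (E.i1 K) ⟶ _) p := H
  obtain ⟨k, h₁, h₂⟩ := exists_lift_of_hasLiftingProperty H (pushout.desc c h hc) b (by
    apply pushout.hom_ext <;> simp [pushout.inl_desc_assoc, pushout.inr_desc_assoc,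
        hcb, hhb])
  refine ⟨k, ?_, ?_, h₂⟩
  · simpa [pushout.inl_desc, pushout.inl_desc_assoc] using pushout.inl _ _ ≫= h₁
  · simpa [pushout.inr_desc, pushout.inr_desc_assoc] using pushout.inr _ _ ≫= h₁

variable {An L : MorphismProperty C}

lemma exists_extend_box1 {K M W : C} {i : K ⟶ M} (hW : IsFibrantObj An W) (hi : An (E.box1 i))
    (c : M ⟶ W) (h : E.I.obj K ⟶ W) (hc : i ≫ c = E.i1 K ≫ h) :
    ∃ k : E.I.obj M ⟶ W, E.i1 M ≫ k = c ∧ E.I.map i ≫ k = h := by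
  replace hi : An (pushout.desc (E.i1 M) (E.I.map i) (E.i1_naturality i) :
    pushout i (E.i1 K) ⟶ _) := hi
  obtain ⟨k, h₁⟩ := hW _ hi (pushout.desc c h hc)
  refine ⟨k, ?_, ?_⟩
  · simpa [pushout.inl_desc, pushout.inl_desc_assoc] using pushout.inl _ _ ≫= h₁
  · simpa [pushout.inr_desc, pushout.inr_desc_assoc] using pushout.inr _ _ ≫= h₁

lemma exists_extend_boundaryBox {K M W : C} {i : K ⟶ M} (hW : IsFibrantObj An W)
    (hi : An (E.boundaryBox i)) (f g : M ⟶ W) (h : E.I.obj K ⟶ W)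
    (hf : i ≫ f = E.i0 K ≫ h) (hg : i ≫ g = E.i1 K ≫ h) :
    ∃ k : E.I.obj M ⟶ W, E.i0 M ≫ k = f ∧ E.i1 M ≫ k = g ∧ E.I.map i ≫ k = h := by
  replace hi : An (pushout.desc (E.ι M) (E.I.map i) (E.ι_naturality i) :
    pushout (coprod.map i i) (E.ι K) ⟶ _) := hi
  obtain ⟨k, h₁⟩ := hW _ hi (pushout.desc (coprod.desc f g) h (by
    apply coprod.hom_ext <;> simp [hf, hg, coprod.inl_desc, coprod.inr_desc]))
  have h₂ := pushout.inl _ _ ≫= h₁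
  simp only [pushout.inl_desc, pushout.inl_desc_assoc] at h₂
  refine ⟨k, ?_, ?_, ?_⟩
  · simpa [coprod.inl_desc] using coprod.inl ≫= h₂
  · simpa [coprod.inr_desc] using coprod.inr ≫= h₂
  · simpa [pushout.inr_desc, pushout.inr_desc_assoc] using pushout.inr _ _ ≫= h₁

end Cylinder

/-! ### Homotopies into fibrant objects -/

section

variable [HasColimits C] {L An : MorphismProperty C} {E : Cylinder C}

/-- Filling the missing side of a square of homotopies into a fibrant object. -/
lemma IsRightAnodyneClass.exists_side (hE : IsExactCylinder E L) (hAn : IsRightAnodyneClass E L An)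
    {A W : C} (hW : IsFibrantObj An W) (α β₀ β₁ : E.I.obj A ⟶ W)
    (h₀ : E.i0 A ≫ α = E.i1 A ≫ β₀) (h₁ : E.i1 A ≫ α = E.i1 A ≫ β₁) :
    ∃ γ : E.I.obj A ⟶ W, E.i0 A ≫ γ = E.i0 A ≫ β₀ ∧
      E.i1 A ≫ γ = E.i0 A ≫ β₁ := by
  have := hE.preservesColimits
  obtain ⟨b, hb₀, hb₁⟩ := E.exists_desc_map_coprod β₀ β₁
  obtain ⟨H, hH, hH'⟩ := E.exists_extend_box1 hW (hAn.box1_mem _ (hE.ι_mem A)) α b (by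
    apply coprod.hom_ext
    · rw [E.i1_naturality_assoc, hb₀]
      simpa using h₀
    · rw [E.i1_naturality_assoc, hb₁]
      simpa using h₁)
  refine ⟨E.i0 _ ≫ H, ?_, ?_⟩
  · rw [← hb₀, ← hH', E.i0_naturality_assoc, ← Functor.map_comp_assoc, E.inl_ι]
  · rw [← hb₁, ← hH', E.i0_naturality_assoc, ← Functor.map_comp_assoc, E.inr_ι]

/-- The relative version of `exists_side`, for a fibration. -/
lemma IsRightAnodyneClass.exists_side_over (hE : IsExactCylinder E L)
    (hAn : IsRightAnodyneClass E L An)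
    {A X Y : C} {p : X ⟶ Y} (hp : IsFib An p) (α β₀ β₁ : E.I.obj A ⟶ X)
    (h₀ : E.i0 A ≫ α = E.i1 A ≫ β₀) (h₁ : E.i1 A ≫ α = E.i1 A ≫ β₁)
    (Q : E.I.obj (E.I.obj A) ⟶ Y) (hQ : α ≫ p = E.i1 _ ≫ Q)
    (hQ₀ : β₀ ≫ p = E.I.map (E.i0 A) ≫ Q) (hQ₁ : β₁ ≫ p = E.I.map (E.i1 A) ≫ Q) :
    ∃ γ : E.I.obj A ⟶ X, E.i0 A ≫ γ = E.i0 A ≫ β₀ ∧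
      E.i1 A ≫ γ = E.i0 A ≫ β₁ ∧ γ ≫ p = E.i0 _ ≫ Q := by
  have := hE.preservesColimits
  obtain ⟨b, hb₀, hb₁⟩ := E.exists_desc_map_coprod β₀ β₁
  obtain ⟨H, hH, hH', hH''⟩ := E.exists_lift_box1
    (hp _ (hAn.box1_mem _ (hE.ι_mem A))) α b Q (by
      apply coprod.hom_ext
      · rw [E.i1_naturality_assoc, hb₀]
        simpa using h₀
      · rw [E.i1_naturality_assoc, hb₁]
        simpa using h₁) hQ (by
      apply E.map_coprod_hom_ext
      · rw [← Category.assoc, hb₀, hQ₀, ← Functor.map_comp_assoc, E.inl_ι]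
      · rw [← Category.assoc, hb₁, hQ₁, ← Functor.map_comp_assoc, E.inr_ι])
  refine ⟨E.i0 _ ≫ H, ?_, ?_, by simp [hH'']⟩
  · rw [← hb₀, ← hH', E.i0_naturality_assoc, ← Functor.map_comp_assoc, E.inl_ι]
  · rw [← hb₁, ← hH', E.i0_naturality_assoc, ← Functor.map_comp_assoc, E.inr_ι]

lemma Cylinder.Homotopy.symm (hE : IsExactCylinder E L) (hAn : IsRightAnodyneClass E L An)
    {A W : C} (hW : IsFibrantObj An W) {f g : A ⟶ W} (h : E.Homotopy f g) : E.Homotopy g f := by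
  obtain ⟨H, rfl, rfl⟩ := E.homotopy_iff.1 h
  obtain ⟨γ, h₀, h₁⟩ := hAn.exists_side hE hW (E.proj A ≫ E.i1 A ≫ H)
    (E.proj A ≫ E.i1 A ≫ H) H (by simp)
    (by simp)
  exact E.homotopy_iff.2 ⟨γ, by simpa using h₀, h₁⟩

lemma Cylinder.Homotopy.trans (hE : IsExactCylinder E L) (hAn : IsRightAnodyneClass E L An)
    {A W : C} (hW : IsFibrantObj An W) {f g k : A ⟶ W} (h : E.Homotopy f g)
    (h' : E.Homotopy g k) : E.Homotopy f k := by
  obtain ⟨H, rfl, rfl⟩ := E.homotopy_iff.1 h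
  obtain ⟨H', h₀, rfl⟩ := E.homotopy_iff.1 h'
  obtain ⟨γ, h₀, h₁⟩ := hAn.exists_side hE hW H' H (E.proj A ≫ E.i1 A ≫ H') h₀
    (by simp)
  exact E.homotopy_iff.2 ⟨γ, h₀, by simpa using h₁⟩

lemma homotopy_of_quot_mk_eq (hE : IsExactCylinder E L) (hAn : IsRightAnodyneClass E L An)
    {A W : C} (hW : IsFibrantObj An W) {f g : A ⟶ W}
    (h : (Quot.mk _ f : E.HoHom A W) = Quot.mk _ g) : E.Homotopy f g := by
  replace h := Quot.eqvGen_exact h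
  induction h with
  | rel _ _ h => exact h
  | refl _ => exact Cylinder.Homotopy.refl E _
  | symm _ _ h ih => exact ih.symm hE hAn hW
  | trans _ _ _ h h' ih ih' =>
    exact ih.trans hE hAn hW ih'

/-! ### Weak equivalences -/

lemma isWeakEq_id (X : C) : IsWeakEq E An (𝟙 X) := fun W _ => by
  rw [E.precompQ_id]
  exact Function.bijective_id

lemma IsWeakEq.comp {X Y Z : C} {f : X ⟶ Y} {g : Y ⟶ Z} (hf : IsWeakEq E An f)
    (hg : IsWeakEq E An g) : IsWeakEq E An (f ≫ g) := fun W hW => by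
  rw [E.precompQ_comp]
  exact (hf W hW).comp (hg W hW)

lemma IsWeakEq.of_comp_left {X Y Z : C} {f : X ⟶ Y} {g : Y ⟶ Z} (hf : IsWeakEq E An f)
    (hfg : IsWeakEq E An (f ≫ g)) : IsWeakEq E An g := fun W hW => by
  have := hfg W hW
  rw [E.precompQ_comp] at this
  exact (Function.Bijective.of_comp_iff' (hf W hW) _).1 this

lemma IsWeakEq.of_comp_right {X Y Z : C} {f : X ⟶ Y} {g : Y ⟶ Z} (hg : IsWeakEq E An g)
    (hfg : IsWeakEq E An (f ≫ g)) : IsWeakEq E An f := fun W hW => by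
  have := hfg W hW
  rw [E.precompQ_comp] at this
  exact (Function.Bijective.of_comp_iff _ (hg W hW)).1 this

/-- The two-out-of-six property, for the composable triple `f`, `g`, `h`. -/
lemma IsWeakEq.of_comp_comp {X Y Z T : C} {f : X ⟶ Y} {g : Y ⟶ Z} {h : Z ⟶ T}
    (hfg : IsWeakEq E An (f ≫ g)) (hgh : IsWeakEq E An (g ≫ h)) : IsWeakEq E An f := by
  have hg : IsWeakEq E An g := fun W hW => by
    have h₁ := hfg W hW
    have h₂ := hgh W hW
    rw [E.precompQ_comp] at h₁ h₂
    exact ⟨h₁.1.of_comp, h₂.2.of_comp⟩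
  exact hg.of_comp_right hfg

lemma IsWeakEq.of_retract {X Y X' Y' : C} {f : X ⟶ Y} {f' : X' ⟶ Y'} (h : IsRetractOf f f')
    (hf' : IsWeakEq E An f') : IsWeakEq E An f := fun W hW => by
  obtain ⟨i, r, j, s, hir, hjs, w₁, w₂⟩ := h
  have e₁ := congrArg (fun k => E.precompQ k W) hir
  have e₂ := congrArg (fun k => E.precompQ k W) hjs
  have e₃ := congrArg (fun k => E.precompQ k W) w₁
  have e₄ := congrArg (fun k => E.precompQ k W) w₂
  simp only [E.precompQ_comp, E.precompQ_id] at e₁ e₂ e₃ e₄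
  constructor
  · intro a b hab
    have : E.precompQ s W a = E.precompQ s W b := (hf' W hW).1 (by
      have ha := congrFun e₄ a
      have hb := congrFun e₄ b
      simp only [Function.comp_apply] at ha hb
      rw [ha, hb, hab])
    have ha := congrFun e₂ a
    have hb := congrFun e₂ b
    simp only [Function.comp_apply, id] at ha hb
    rw [← ha, ← hb, this]
  · intro b
    obtain ⟨a, ha⟩ := (hf' W hW).2 (E.precompQ r W b)
    refine ⟨E.precompQ j W a, ?_⟩
    have h₁ := congrFun e₃ a
    have h₂ := congrFun e₁ b
    simp only [Function.comp_apply, id] at h₁ h₂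
    rw [← h₁, ha, h₂]

lemma IsWeakEq.of_homotopy_inverse {X Y : C} {f : X ⟶ Y} (g : Y ⟶ X)
    (h₁ : E.precompQ (f ≫ g) = E.precompQ (𝟙 X)) (h₂ : E.precompQ (g ≫ f) = E.precompQ (𝟙 Y)) :
    IsWeakEq E An f := fun W _ => by
  have h₁ := congrFun h₁ W
  have h₂ := congrFun h₂ W
  rw [E.precompQ_comp, E.precompQ_id] at h₁ h₂
  exact Function.bijective_iff_has_inverse.2 ⟨E.precompQ g W, congrFun h₂, congrFun h₁⟩

end

/-! ### Fibrations and trivial cofibrations -/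

section

variable [HasColimits C] {L An : MorphismProperty C} {E : Cylinder C}

lemma isWeakEq_of_rlp (hE : IsExactCylinder E L) (hL : ∀ X : C, L (initial.to X))
    {X Y : C} {p : X ⟶ Y} (hp : rlp L p) : IsWeakEq E An p := by
  obtain ⟨s, -, hs⟩ := exists_lift_of_hasLiftingProperty (hp _ (hL Y)) (initial.to X) (𝟙 Y)
    (initialIsInitial.hom_ext _ _)
  obtain ⟨h, h₁, -⟩ := exists_lift_of_hasLiftingProperty (hp _ (hE.ι_mem X))
    (coprod.desc (p ≫ s) (𝟙 X)) (E.proj X ≫ p) (by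
      apply coprod.hom_ext <;> simp [coprod.inl_desc, coprod.inr_desc, hs])
  have H : E.Homotopy (p ≫ s) (𝟙 X) := E.homotopy_iff.2 ⟨h,
    by simpa [coprod.inl_desc] using coprod.inl ≫= h₁,
    by simpa [coprod.inr_desc] using coprod.inr ≫= h₁⟩
  refine IsWeakEq.of_homotopy_inverse s (funext H.precompQ_eq) ?_
  rw [hs]

lemma IsRightAnodyneClass.isWeakEq (hE : IsExactCylinder E L) (hAn : IsRightAnodyneClass E L An)
    {A B : C} {i : A ⟶ B} (hi : An i) : IsWeakEq E An i := fun W hW => by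
  constructor
  · intro f g h
    induction f using Quot.ind with | _ f
    induction g using Quot.ind with | _ g
    obtain ⟨k, h₀, h₁⟩ := E.homotopy_iff.1 (homotopy_of_quot_mk_eq hE hAn hW h)
    obtain ⟨k', h₀', h₁', -⟩ := E.exists_extend_boundaryBox hW (hAn.boundaryBox_mem _ hi) f g k
      h₀.symm h₁.symm
    exact Quot.sound (E.homotopy_iff.2 ⟨k', h₀', h₁'⟩)
  · intro f
    induction f using Quot.ind with | _ f
    obtain ⟨b, hb⟩ := hW _ hi f
    exact ⟨Quot.mk _ b, congrArg (Quot.mk _) hb⟩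

lemma IsFib.isFibrantObj {X Y : C} {p : X ⟶ Y} (hp : IsFib An p) (hY : IsFibrantObj An Y) :
    IsFibrantObj An X := fun _ _ f hf a => by
  obtain ⟨b, hb⟩ := hY f hf (a ≫ p)
  obtain ⟨l, hl, -⟩ := exists_lift_of_hasLiftingProperty (hp f hf) a b hb.symm
  exact ⟨l, hl⟩

/-- Fibrant objects have the extension property with respect to all morphisms of `L` that are
weak equivalences. -/
lemma IsFibrantObj.exists_extend (hE : IsExactCylinder E L) (hAn : IsRightAnodyneClass E L An)
    {A B W : C} (hW : IsFibrantObj An W) {i : A ⟶ B} (hi : L i) (hi' : IsWeakEq E An i)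
    (a : A ⟶ W) : ∃ b : B ⟶ W, i ≫ b = a := by
  obtain ⟨b, hb⟩ := (hi' W hW).2 (Quot.mk _ a)
  induction b using Quot.ind with | _ b
  obtain ⟨h, h₀, h₁⟩ := E.homotopy_iff.1 ((homotopy_of_quot_mk_eq hE hAn hW hb).symm hE hAn hW)
  obtain ⟨k, hk₁, hk⟩ := E.exists_extend_box1 hW (hAn.box1_mem i hi) b h h₁.symm
  exact ⟨E.i0 _ ≫ k, by rw [E.i0_naturality_assoc, hk, h₀]⟩

/-- A fibration between fibrant objects that is a weak equivalence has a section that is a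
fiberwise homotopy inverse. -/
lemma IsFib.exists_section (hE : IsExactCylinder E L) (hAn : IsRightAnodyneClass E L An)
    (hL : ∀ X : C, L (initial.to X)) {X Y : C} {q : X ⟶ Y} (hq : IsFib An q)
    (hX : IsFibrantObj An X) (hY : IsFibrantObj An Y) (hq' : IsWeakEq E An q) :
    ∃ (s : Y ⟶ X) (θ : E.I.obj X ⟶ X), s ≫ q = 𝟙 Y ∧ E.i0 X ≫ θ = 𝟙 X ∧
      E.i1 X ≫ θ = q ≫ s ∧ θ ≫ q = E.proj X ≫ q := by
  have := hE.preservesColimits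
  obtain ⟨s, hs⟩ := (hq' X hX).2 (Quot.mk _ (𝟙 X))
  induction s using Quot.ind with | _ s
  replace hs : E.Homotopy (q ≫ s) (𝟙 X) := homotopy_of_quot_mk_eq hE hAn hX hs
  have hs' : E.Homotopy (𝟙 Y) (s ≫ q) := by
    refine homotopy_of_quot_mk_eq hE hAn hY ((hq' Y hY).1 ?_)
    refine Eq.trans (congrArg (Quot.mk _) ?_) (Quot.sound (hs.postcomp q)).symm |>.trans
      (congrArg (Quot.mk _) ?_)
    · simp
    · simp
  obtain ⟨h, h₀, h₁⟩ := E.homotopy_iff.1 hs'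
  have hI : IsInitial (E.I.obj (⊥_ C)) := initialIsInitial.isInitialObj E.I _
  obtain ⟨k, hk₁, -, hk⟩ := E.exists_lift_box1 (hq _ (hAn.box1_mem _ (hL Y))) s (hI.to X) h
    (initialIsInitial.hom_ext _ _) h₁.symm (hI.hom_ext _ _)
  obtain ⟨s', hs', H⟩ : ∃ s' : Y ⟶ X, s' ≫ q = 𝟙 Y ∧ E.Homotopy s' s :=
    ⟨E.i0 Y ≫ k, by rw [Category.assoc, hk, h₀], E.homotopy_iff.2 ⟨k, rfl, hk₁⟩⟩
  obtain ⟨h, h₀, h₁⟩ := E.homotopy_iff.1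
    (((H.precomp q).trans hE hAn hX hs).symm hE hAn hX)
  obtain ⟨θ, θ₀, θ₁, hθ⟩ := hAn.exists_side_over hE hq (E.proj X ≫ q ≫ s') h (h ≫ q ≫ s')
    (by simp [h₁]) (by simp [reassoc_of% h₁, reassoc_of% hs'])
    (E.I.map (E.proj X) ≫ h ≫ q)
    (by rw [← E.i1_naturality_assoc, reassoc_of% h₁]; simp [hs'])
    (by rw [← Functor.map_comp_assoc]; simp)
    (by rw [← Functor.map_comp_assoc]; simp [hs'])
  refine ⟨s', θ, hs', by rw [θ₀, h₀], by rw [θ₁, reassoc_of% h₀], ?_⟩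
  rw [hθ, ← E.i0_naturality_assoc, reassoc_of% h₀]

/-- A fibration between fibrant objects that is a weak equivalence has the right lifting property
with respect to `L`. -/
lemma IsFib.rlp_of_isWeakEq (hE : IsExactCylinder E L) (hAn : IsRightAnodyneClass E L An)
    (hL : ∀ X : C, L (initial.to X)) {X Y : C} {q : X ⟶ Y} (hq : IsFib An q)
    (hX : IsFibrantObj An X) (hY : IsFibrantObj An Y) (hq' : IsWeakEq E An q) : rlp L q := by
  obtain ⟨s, θ, hs, θ₀, θ₁, hθ⟩ := hq.exists_section hE hAn hL hX hY hq'
  intro A B i hi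
  refine hasLiftingProperty_of_exists_lift fun a b w => ?_
  obtain ⟨k, -, hk, hk'⟩ := E.exists_lift_box1 (hq _ (hAn.box1_mem _ hi)) (b ≫ s)
    (E.I.map a ≫ θ) (E.proj B ≫ b) (by rw [← E.i1_naturality_assoc, θ₁, reassoc_of% w])
    (by simp [hs]) (by
      rw [Category.assoc, hθ, ← Category.assoc, ← Category.assoc, E.proj_naturality,
        E.proj_naturality, Category.assoc, Category.assoc, w])
  exact ⟨E.i0 B ≫ k, by rw [E.i0_naturality_assoc, hk, ← E.i0_naturality_assoc, θ₀,
    Category.comp_id], by rw [Category.assoc, hk', E.i0_proj_assoc]⟩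

lemma isWeakEq_iff_forall_hasLiftingProperty (hE : IsExactCylinder E L)
    (hAn : IsRightAnodyneClass E L An) (hL : ∀ X : C, L (initial.to X))
    (hfac : ∀ ⦃X Y : C⦄ (f : X ⟶ Y), ∃ (Z : C) (i : X ⟶ Z) (p : Z ⟶ Y),
      An i ∧ IsFib An p ∧ i ≫ p = f)
    (hrep : ∀ X : C, ∃ (X' : C) (i : X ⟶ X'), An i ∧ IsFibrantObj An X')
    {A B : C} {i : A ⟶ B} (hi : L i) :
    IsWeakEq E An i ↔ ∀ ⦃X Y : C⦄ (p : X ⟶ Y), IsFibrantObj An X → IsFibrantObj An Y →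
      IsFib An p → HasLiftingProperty i p := by
  obtain ⟨B', jB, hjB, hB'⟩ := hrep B
  obtain ⟨A', jA, q, hjA, hq, w⟩ := hfac (i ≫ jB)
  have hA' := hq.isFibrantObj hB'
  constructor
  · intro hi' X Y p hX hY hp
    refine hasLiftingProperty_of_exists_lift fun a b wab => ?_
    have hq' : IsWeakEq E An q :=
      (hAn.isWeakEq hE hjA).of_comp_left (by rw [w]; exact hi'.comp (hAn.isWeakEq hE hjB))
    obtain ⟨l, hl, hl'⟩ := exists_lift_of_hasLiftingProperty
      (hq.rlp_of_isWeakEq hE hAn hL hA' hB' hq' i hi) jA jB w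
    obtain ⟨b', hb'⟩ := hY _ hjB b
    obtain ⟨a', ha', ha''⟩ := exists_lift_of_hasLiftingProperty (hp _ hjA) a (q ≫ b')
      (by rw [wab, reassoc_of% w, hb'])
    exact ⟨l ≫ a', by rw [reassoc_of% hl, ha'], by rw [Category.assoc, ha'', reassoc_of% hl', hb']⟩
  · intro H
    obtain ⟨l, hl, hl'⟩ := exists_lift_of_hasLiftingProperty (H q hA' hB' hq) jA jB w
    refine IsWeakEq.of_comp_comp (g := l) (h := q) ?_ ?_
    · rw [hl]
      exact hAn.isWeakEq hE hjA
    · rw [hl']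
      exact hAn.isWeakEq hE hjB

end

/-! ### Retracts -/

lemma IsRetractOf.hasLiftingProperty_left {X Y X' Y' A B : C} {f : X ⟶ Y} {f' : X' ⟶ Y'}
    (h : IsRetractOf f f') {p : A ⟶ B} (hf' : HasLiftingProperty f' p) :
    HasLiftingProperty f p := by
  obtain ⟨i, r, j, s, hir, hjs, w₁, w₂⟩ := h
  refine hasLiftingProperty_of_exists_lift fun a b w => ?_
  obtain ⟨l, hl, hl'⟩ := exists_lift_of_hasLiftingProperty hf' (r ≫ a) (s ≫ b)
    (by rw [Category.assoc, w, reassoc_of% w₂])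
  exact ⟨j ≫ l, by rw [← reassoc_of% w₁, hl, reassoc_of% hir],
    by rw [Category.assoc, hl', reassoc_of% hjs]⟩

lemma IsRetractOf.hasLiftingProperty_right {X Y X' Y' A B : C} {f : X ⟶ Y} {f' : X' ⟶ Y'}
    (h : IsRetractOf f f') {p : A ⟶ B} (hf' : HasLiftingProperty p f') :
    HasLiftingProperty p f := by
  obtain ⟨i, r, j, s, hir, hjs, w₁, w₂⟩ := h
  refine hasLiftingProperty_of_exists_lift fun a b w => ?_
  obtain ⟨l, hl, hl'⟩ := exists_lift_of_hasLiftingProperty hf' (a ≫ i) (b ≫ j)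
    (by rw [Category.assoc, w₁, reassoc_of% w])
  exact ⟨l ≫ r, by rw [reassoc_of% hl, hir, Category.comp_id],
    by rw [Category.assoc, ← w₂, reassoc_of% hl', hjs, Category.comp_id]⟩

lemma isRetractOf_right_factor {X Y Z : C} {i : X ⟶ Z} {p : Z ⟶ Y} {f : X ⟶ Y} (w : i ≫ p = f)
    (h : HasLiftingProperty i f) : IsRetractOf f p := by
  obtain ⟨l, hl, hl'⟩ := exists_lift_of_hasLiftingProperty h (𝟙 X) p (by simp [w])
  exact ⟨i, l, 𝟙 Y, 𝟙 Y, hl, by simp, by simp [w], by simp [hl']⟩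

lemma isRetractOf_left_factor {X Y Z : C} {i : X ⟶ Z} {p : Z ⟶ Y} {f : X ⟶ Y} (w : i ≫ p = f)
    (h : HasLiftingProperty f p) : IsRetractOf f i := by
  obtain ⟨l, hl, hl'⟩ := exists_lift_of_hasLiftingProperty h i (𝟙 Y) (by simp [w])
  exact ⟨𝟙 X, 𝟙 X, l, p, by simp, hl', by simp [hl], by simp [w]⟩

/-! ### Assembling the model structure -/

lemma ModelStructure.ext' {M M' : ModelStructure C} (h₁ : M.weq = M'.weq) (h₂ : M.cof = M'.cof)
    (h₃ : M.fib = M'.fib) : M = M' := by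
  cases M
  cases M'
  subst h₁ h₂ h₃
  rfl

/-- In a model structure the fibrations are determined by the trivial cofibrations. -/
lemma ModelStructure.fib_eq (M : ModelStructure C) :
    M.fib = rlp (fun _ _ f => M.cof f ∧ M.weq f) := by
  ext X Y p
  refine ⟨fun hp A B i hi => M.lift_trivCof_fib i p hi.1 hi.2 hp, fun hp => ?_⟩
  obtain ⟨Z, i, q, hi, hi', hq, w⟩ := M.fact_trivCof_fib p
  exact M.fib_retract _ _ (isRetractOf_right_factor w (hp i ⟨hi, hi'⟩)) hq

theorem exists_modelStructure [HasColimits C]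
    {L R : MorphismProperty C} (hW : IsCofGenWFS L R)
    {E : Cylinder C} (hE : IsExactCylinder E L)
    {An : MorphismProperty C} (hAn : IsRightAnodyneClass E L An)
    (hfac : ∀ ⦃X Y : C⦄ (f : X ⟶ Y), ∃ (Z : C) (i : X ⟶ Z) (p : Z ⟶ Y),
      An i ∧ IsFib An p ∧ i ≫ p = f)
    (hrep : ∀ X : C, ∃ (X' : C) (i : X ⟶ X'), An i ∧ IsFibrantObj An X')
    (hfac' : ∀ ⦃X Y : C⦄ (f : X ⟶ Y), ∃ (Z : C) (i : X ⟶ Z) (p : Z ⟶ Y),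
      (L i ∧ IsWeakEq E An i) ∧ rlp (fun _ _ f => L f ∧ IsWeakEq E An f) p ∧ i ≫ p = f) :
    ∃ M : ModelStructure C,
      M.cof = L ∧
      (∀ ⦃A B : C⦄ (f : A ⟶ B), M.weq f ↔ IsWeakEq E An f) ∧
      (∀ W : C, M.Fibrant W ↔ IsFibrantObj An W) ∧
      (∀ ⦃X Y : C⦄ (p : X ⟶ Y), IsFibrantObj An X → IsFibrantObj An Y →
        (M.fib p ↔ IsFib An p)) ∧
      (∀ M' : ModelStructure C, M'.cof = L →
        (∀ ⦃A B : C⦄ (f : A ⟶ B), M'.weq f ↔ IsWeakEq E An f) → M' = M) := by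
  have hL := hW.initial_mem
  have hR {X Y : C} {p : X ⟶ Y} (hp : R p) : rlp L p := by
    rw [← hW.rlp_eq]
    exact hp
  let M : ModelStructure C :=
    { weq := fun _ _ f => IsWeakEq E An f
      cof := L
      fib := rlp (fun _ _ f => L f ∧ IsWeakEq E An f)
      weq_id := isWeakEq_id
      weq_comp := fun _ _ _ _ _ => IsWeakEq.comp
      weq_cancel_left := fun _ _ _ _ _ => IsWeakEq.of_comp_left
      weq_cancel_right := fun _ _ _ _ _ => IsWeakEq.of_comp_right
      weq_retract := fun _ _ _ _ _ _ => IsWeakEq.of_retract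
      cof_retract := fun _ _ _ _ f f' h hf' => by
        obtain ⟨S, -, rfl⟩ := hW.exists_generating_set
        exact fun _ _ g hg => h.hasLiftingProperty_left (hf' g hg)
      fib_retract := fun _ _ _ _ f f' h hf' _ _ i hi => h.hasLiftingProperty_right (hf' i hi)
      lift_trivCof_fib := fun _ _ _ _ i p hi hi' hp => hp i ⟨hi, hi'⟩
      lift_cof_trivFib := fun _ _ _ _ i p hi hp hp' => by
        obtain ⟨Z, j, q, hj, hq, w⟩ := hW.factorization p
        have hj' : IsWeakEq E An j :=
          (isWeakEq_of_rlp hE hL (hR hq)).of_comp_right (by rwa [w])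
        exact (isRetractOf_right_factor w (hp j ⟨hj, hj'⟩)).hasLiftingProperty_right
          (hR hq i hi)
      fact_cof_trivFib := fun X Y f => by
        obtain ⟨Z, j, q, hj, hq, w⟩ := hW.factorization f
        exact ⟨Z, j, q, hj, fun _ _ i hi => hR hq i hi.1, isWeakEq_of_rlp hE hL (hR hq), w⟩
      fact_trivCof_fib := fun X Y f => by
        obtain ⟨Z, i, p, hi, hp, w⟩ := hfac' f
        exact ⟨Z, i, p, hi.1, hi.2, hp, w⟩ }
  refine ⟨M, rfl, fun _ _ _ => Iff.rfl,
    fun W => ⟨fun h A B f hf a => ?_, fun h A B i hi hi' a => ?_⟩,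
    fun X Y p hX hY => ⟨fun h A B i hi => ?_, fun h A B i hi => ?_⟩, fun M' hM' hM'' => ?_⟩
  · exact h f (hAn.le _ hf) (hAn.isWeakEq hE hf) a
  · exact h.exists_extend hE hAn hi hi' a
  · exact h i ⟨hAn.le _ hi, hAn.isWeakEq hE hi⟩
  · exact (isWeakEq_iff_forall_hasLiftingProperty hE hAn hL hfac hrep hi.1).1 hi.2 p hX hY h
  · have e : M'.weq = M.weq := by
      ext A B f
      exact hM'' f
    exact ModelStructure.ext' e hM' (by rw [M'.fib_eq, M.fib_eq, hM', e])

lemma isCardinalFiltered_of_type (J : Type v) [SmallCategory J] (κ : Cardinal.{v})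
    [Fact κ.IsRegular] [CategoryTheory.IsCardinalFiltered J κ] :
    IsCardinalFiltered (Cat.of J) κ := fun K hK F =>
  CategoryTheory.IsCardinalFiltered.nonempty_cocone (κ := κ) (show K ⥤ J from F)
    ((hasCardinalLT_iff_cardinal_mk_lt _ _).2 hK)

lemma IsCardinalFiltered.toMathlib {J : Cat.{v, v}} {κ : Cardinal.{v}} [Fact κ.IsRegular]
    (h : IsCardinalFiltered J κ) : CategoryTheory.IsCardinalFiltered J κ where
  nonempty_cocone {A} _ F hA :=
    h (Cat.of A) ((hasCardinalLT_iff_cardinal_mk_lt _ _).1 hA) F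

lemma IsPresentableObj.isCardinalPresentable {κ : Cardinal.{v}} [Fact κ.IsRegular] {X : C}
    (h : IsPresentableObj κ X) : IsCardinalPresentable X κ where
  preservesColimitOfShape J _ _ := h (Cat.of J) (isCardinalFiltered_of_type J κ)

variable (C) in
lemma LocallyPresentable.exists_isCardinalLocallyPresentable [h : LocallyPresentable C] :
    ∃ (κ : Cardinal.{v}) (_ : Fact κ.IsRegular), IsCardinalLocallyPresentable C κ := by
  obtain ⟨κ, hκ, ι, G, hG, hX⟩ := h.exists_presentable_generator
  have : Fact κ.IsRegular := ⟨hκ⟩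
  refine ⟨κ, this, ?_⟩
  have hP : (ObjectProperty.ofObj G).isoClosure.IsCardinalFilteredGenerator κ :=
    { le_isCardinalPresentable := by
        rw [ObjectProperty.isoClosure_le_iff]
        rintro _ ⟨i⟩
        exact (hG i).isCardinalPresentable
      exists_colimitsOfShape := fun X => by
        obtain ⟨J, F, c, hJ, ⟨hc⟩, hF, ⟨e⟩⟩ := hX X
        refine ⟨J, inferInstance, hJ.toMathlib, ?_⟩
        refine ⟨{ diag := F, ι := c.ι ≫ (Functor.const J).map e.hom,
                  isColimit := hc.ofIsoColimit (Cocone.ext e),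
                  prop_diag_obj := fun j => ?_ }⟩
        obtain ⟨i, ⟨e⟩⟩ := hF j
        exact ⟨_, ⟨i⟩, ⟨e⟩⟩ }
  have := hP.hasCardinalFilteredGenerator
  exact { }

/-- Any small family of objects of a locally presentable category is `κ`-presentable for
some regular `κ` which may be chosen larger than a given cardinal. -/
lemma LocallyPresentable.exists_cardinal_forall [LocallyPresentable C] (κ₀ : Cardinal.{v})
    {T : Type v} (G : T → C) :
    ∃ (κ : Cardinal.{v}) (_ : Fact κ.IsRegular), κ₀ ≤ κ ∧ IsCardinalLocallyPresentable C κ ∧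
      ∀ t, IsCardinalPresentable (G t) κ := by
  obtain ⟨κ₁, _, _⟩ := LocallyPresentable.exists_isCardinalLocallyPresentable C
  have : IsLocallyPresentable.{v} C := ⟨κ₁, inferInstance, inferInstance⟩
  have hG : ∀ t, ∃ (κ : Cardinal.{v}) (_ : Fact κ.IsRegular), IsCardinalPresentable (G t) κ :=
    fun t => Functor.IsAccessible.exists_cardinal
  choose κ' hκ' hG using hG
  obtain ⟨κ, hκ, h⟩ := HasCardinalLT.exists_regular_cardinal_forall.{v}
    (Sum.elim κ' (fun b : Bool => if b then κ₀ else κ₁) · |>.ord.ToType)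
  have : Fact κ.IsRegular := ⟨hκ⟩
  simp only [hasCardinalLT_iff_cardinal_mk_lt, Cardinal.mk_toType, Cardinal.card_ord] at h
  have h₁ : κ₁ ≤ κ := (h (.inr false)).le
  exact ⟨κ, this, (h (.inr true)).le, IsCardinalLocallyPresentable.of_le C h₁, fun t =>
    have := hκ' t
    isCardinalPresentable_of_le (κ := κ' t) _ (h (.inl t)).le⟩

lemma rlp_eq (T : MorphismProperty C) : rlp T = T.rlp := by
  ext X Y f
  exact ⟨fun h _ _ i hi => h i hi, fun h _ _ i hi => h i hi⟩

lemma llp_eq (T : MorphismProperty C) : llp T = T.llp := by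
  ext X Y f
  exact ⟨fun h _ _ i hi => h i hi, fun h _ _ i hi => h i hi⟩

lemma hasSmallObjectArgument [LocallyPresentable C] (S : Set (Arrow C)) [Small.{v} S] :
    MorphismProperty.HasSmallObjectArgument.{v} (ofArrows S) := by
  obtain ⟨κ, _, _, _, h⟩ := LocallyPresentable.exists_cardinal_forall (C := C) 0
    (fun s : Shrink S => ((equivShrink S).symm s).1.left)
  have h' : ∀ {A B : C} (i : A ⟶ B), ofArrows S i → IsCardinalPresentable A κ := by
    intro A B i hi
    simpa using h (equivShrink S ⟨_, hi⟩)
  have hne : κ.ord ≠ 0 := by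
    simpa using (Fact.out : κ.IsRegular).ne_zero
  have : Nonempty κ.ord.ToType := Ordinal.nonempty_toType_iff.2 hne
  let _ : OrderBot κ.ord.ToType := WellFoundedLT.toOrderBot _
  have : MorphismProperty.IsSmall.{v} (ofArrows S) := ⟨by
    have : (ofArrows S).toSet = S := rfl
    rw [this]
    infer_instance⟩
  refine ⟨κ, inferInstance, inferInstance, ?_⟩
  exact {
    hasIterationOfShape := { }
    preservesColimit := fun {A B X Y} i hi f hf => by
      have := h' i hi
      have := preservesColimitsOfShape_of_isCardinalPresentable A κ κ.ord.ToType
      infer_instance }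

lemma exists_factorization_of_small [LocallyPresentable C] (S : Set (Arrow C)) [Small.{v} S]
    {X Y : C} (f : X ⟶ Y) :
    ∃ (Z : C) (i : X ⟶ Z) (p : Z ⟶ Y),
      llp (rlp (ofArrows S)) i ∧ rlp (ofArrows S) p ∧ i ≫ p = f := by
  have := hasSmallObjectArgument S
  let d := MorphismProperty.factorizationData (ofArrows S).rlp.llp (ofArrows S).rlp f
  rw [rlp_eq, llp_eq]
  exact ⟨d.Z, d.i, d.p, d.hi, d.hp, d.fac⟩

instance (P : ObjectProperty C) [ObjectProperty.Small.{v} P] :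
    EssentiallySmall.{v} P.FullSubcategory := by
  have : Small.{v} P.FullSubcategory := by
    have : Small.{v} (Subtype P) := inferInstance
    exact small_of_injective (β := Subtype P) (f := fun X => ⟨X.obj, X.property⟩) (by
      rintro ⟨X, _⟩ ⟨Y, _⟩ h
      simpa using h)
  exact essentiallySmall_of_small_of_locallySmall _

variable (C) in
lemma LocallyPresentable.hasTerminal [LocallyPresentable C] : HasTerminal C := by
  obtain ⟨κ, _, _⟩ := LocallyPresentable.exists_isCardinalLocallyPresentable C
  obtain ⟨P, _, hP⟩ := HasCardinalFilteredGenerator.exists_small_generator C κ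
  have : HasColimitsOfShape P.FullSubcategory C :=
    hasColimitsOfShape_of_essentiallySmall.{v} _ _
  have h : ∀ X : C, Nonempty (X ⟶ colimit P.ι) := fun X => by
    obtain ⟨J, _, _, ⟨p⟩⟩ := hP.exists_colimitsOfShape X
    let c : Cocone p.diag := (colimit.cocone P.ι).whisker (P.lift p.diag p.prop_diag_obj)
    exact ⟨p.isColimit.desc c⟩
  have : HasInitial Cᵒᵖ := by
    have : HasWideEqualizers.{v} Cᵒᵖ := inferInstance
    exact hasInitial_of_weakly_initial_and_hasWideEqualizers
      (T := Opposite.op (colimit P.ι)) (fun X => (h X.unop).map Quiver.Hom.op)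
  exact hasTerminal_of_hasInitial_op

lemma IsFibrantObj.of_generators [LocallyPresentable C] {Λ : Set (Arrow C)} {W : C}
    (h : ∀ ⦃A B : C⦄ (f : A ⟶ B), ofArrows Λ f → ∀ a : A ⟶ W, ∃ b : B ⟶ W, f ≫ b = a) :
    IsFibrantObj (llp (rlp (ofArrows Λ))) W := by
  have := LocallyPresentable.hasTerminal C
  have hp : rlp (ofArrows Λ) (terminal.from W) := fun A B f hf =>
    hasLiftingProperty_of_exists_lift (fun a b _ => by
      obtain ⟨b', hb'⟩ := h f hf a
      exact ⟨b', hb', Subsingleton.elim _ _⟩)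
  intro A B f hf a
  obtain ⟨b, hb, _⟩ := exists_lift_of_hasLiftingProperty (hf _ hp) a (terminal.from B)
    (Subsingleton.elim _ _)
  exact ⟨b, hb⟩

lemma preservesColimitsOfShape_of_isColimit {D : Type*} [Category* D] {E : Type*} [Category* E]
    {K K' : Type*} [Category* K] [Category* K'] [HasColimitsOfShape K' E]
    {F : K' ⥤ D ⥤ E} {c : Cocone F} (hc : IsColimit c)
    (h : ∀ k, PreservesColimitsOfShape K (F.obj k)) : PreservesColimitsOfShape K c.pt := by
  have : PreservesColimitsOfShape K F.flip := ⟨fun {G} ↦ ⟨fun {c} hc ↦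
    ⟨evaluationJointlyReflectsColimits _
      (fun k' ↦ isColimitOfPreserves (F.obj k') hc)⟩⟩⟩
  let e : F.flip ⋙ colim ≅ c.pt :=
    NatIso.ofComponents
      (fun j ↦ (colimit.isColimit (F.flip.obj j)).coconePointUniqueUpToIso
        (isColimitOfPreserves ((evaluation _ _).obj j) hc))
      (fun f => colimit.hom_ext (fun k => by simp))
  exact preservesColimitsOfShape_of_natIso e

lemma isCardinalAccessible_of_isColimit {κ : Cardinal.{v}} [Fact κ.IsRegular]
    {K' : Type*} [Category* K'] {D : Type*} [Category* D] [HasColimitsOfShape K' C]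
    {F : K' ⥤ D ⥤ C} {c : Cocone F} (hc : IsColimit c)
    (h : ∀ k, (F.obj k).IsCardinalAccessible κ) : c.pt.IsCardinalAccessible κ where
  preservesColimitOfShape J _ _ := preservesColimitsOfShape_of_isColimit hc (fun k =>
    (F.obj k).preservesColimitsOfShape_of_isCardinalAccessible κ J)

section OneStep

variable [HasColimits C] {T : Type v} {A B : T → C} (f : ∀ t, A t ⟶ B t)

/-- The natural transformation `∐_t ∐_{A t ⟶ X} A t ⟶ ∐_t ∐_{A t ⟶ X} B t`. -/
noncomputable def cellMap :
    (∐ fun t => coyoneda.obj (Opposite.op (A t)) ⋙ sigmaConst.{v}.obj (A t)) ⟶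
      (∐ fun t => coyoneda.obj (Opposite.op (A t)) ⋙ sigmaConst.{v}.obj (B t) : C ⥤ C) :=
  Limits.Sigma.map fun t =>
    Functor.whiskerLeft (coyoneda.obj (Opposite.op (A t))) (sigmaConst.{v}.map (f t))

/-- The natural transformation `∐_t ∐_{A t ⟶ X} A t ⟶ X`. -/
noncomputable def attachingMap (A : T → C) :
    (∐ fun t => coyoneda.obj (Opposite.op (A t)) ⋙ sigmaConst.{v}.obj (A t)) ⟶ 𝟭 C :=
  Limits.Sigma.desc fun t => (sigmaConstAdj (A t)).counit

/-- The functor which attaches to `X` a cell `f t` for every morphism `A t ⟶ X`. -/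
noncomputable def cellFunctor : C ⥤ C := pushout (attachingMap A) (cellMap f)

/-- The inclusion of `X` in the object obtained by attaching cells. -/
noncomputable def cellIncl : 𝟭 C ⟶ cellFunctor f := pushout.inl (attachingMap A) (cellMap f)

lemma cellIncl_mem {W : MorphismProperty C} [W.IsStableUnderCobaseChange]
    [MorphismProperty.IsStableUnderCoproducts.{v} W] [W.RespectsIso]
    (hf : ∀ t, W (f t)) : W.functorCategory C (cellIncl f) := by
  have h₁ : W.functorCategory C (cellMap f) := by
    refine MorphismProperty.colimMap (W := W.functorCategory C) _ ?_
    rintro ⟨t⟩ X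
    exact MorphismProperty.colimMap (W := W) _ (fun _ => hf t)
  exact MorphismProperty.pushout_inl _ _ h₁

lemma exists_extend_cellIncl {X : C} (t : T) (a : A t ⟶ X) :
    ∃ b : B t ⟶ (cellFunctor f).obj X, f t ≫ b = a ≫ (cellIncl f).app X := by
  have h := congr_app (pushout.condition (f := attachingMap A) (g := cellMap f)) X
  have h₁ := congr_app (Limits.Sigma.ι_desc (f := fun t => coyoneda.obj (Opposite.op (A t)) ⋙
    sigmaConst.{v}.obj (A t)) (fun t => (sigmaConstAdj (A t)).counit) t) X
  have h₂ := congr_app (Limits.Sigma.ι_map (fun t =>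
    Functor.whiskerLeft (coyoneda.obj (Opposite.op (A t))) (sigmaConst.{v}.map (f t))) t) X
  let a' : A t ⟶ (sigmaConst.{v}.obj (A t)).obj (A t ⟶ X) :=
    Limits.Sigma.ι (fun _ : A t ⟶ X => A t) a
  let b' : B t ⟶ (sigmaConst.{v}.obj (B t)).obj (A t ⟶ X) :=
    Limits.Sigma.ι (fun _ : A t ⟶ X => B t) a
  have h₃ : a' ≫ (sigmaConst.{v}.map (f t)).app (A t ⟶ X) = f t ≫ b' :=
    Limits.Sigma.ι_map (fun _ : A t ⟶ X => f t) a
  have h₄ : a' ≫ (sigmaConstAdj (A t)).counit.app X = a := Limits.Sigma.ι_desc _ _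
  refine ⟨b' ≫ (Limits.Sigma.ι (fun t => coyoneda.obj (Opposite.op (A t)) ⋙
    sigmaConst.{v}.obj (B t)) t).app X ≫ (pushout.inr (attachingMap A) (cellMap f)).app X, ?_⟩
  have h₂' : (sigmaConst.{v}.map (f t)).app (A t ⟶ X) ≫
      (Limits.Sigma.ι (fun t => coyoneda.obj (Opposite.op (A t)) ⋙
        sigmaConst.{v}.obj (B t)) t).app X = 
      (Limits.Sigma.ι (fun t => coyoneda.obj (Opposite.op (A t)) ⋙
        sigmaConst.{v}.obj (A t)) t).app X ≫ (cellMap f).app X := h₂.symm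
  have h₁' : (Limits.Sigma.ι (fun t => coyoneda.obj (Opposite.op (A t)) ⋙
        sigmaConst.{v}.obj (A t)) t).app X ≫ (attachingMap A).app X =
      (sigmaConstAdj (A t)).counit.app X := h₁
  have h' : (attachingMap A).app X ≫ (cellIncl f).app X =
      (cellMap f).app X ≫ (pushout.inr (attachingMap A) (cellMap f)).app X := h
  have key {A₀ B₀ A₁ B₁ A₂ B₂ X₀ Z : C} {f₀ : A₀ ⟶ B₀} {f₁ : A₁ ⟶ B₁} {f₂ : A₂ ⟶ B₂}
      {a₀ : A₀ ⟶ A₁} {b₀ : B₀ ⟶ B₁} {a₁ : A₁ ⟶ A₂} {b₁ : B₁ ⟶ B₂} {x : A₂ ⟶ X₀}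
      {i : X₀ ⟶ Z} {z : B₂ ⟶ Z} {y : A₁ ⟶ X₀} {y₀ : A₀ ⟶ X₀} (e₀ : a₀ ≫ f₁ = f₀ ≫ b₀)
      (e₁ : f₁ ≫ b₁ = a₁ ≫ f₂) (e₂ : x ≫ i = f₂ ≫ z) (e₃ : a₁ ≫ x = y) (e₄ : a₀ ≫ y = y₀) :
      f₀ ≫ b₀ ≫ b₁ ≫ z = y₀ ≫ i := by
    rw [← reassoc_of% e₀, reassoc_of% e₁, ← e₂, reassoc_of% e₃, reassoc_of% e₄]
  exact key h₃ h₂' h' h₁' h₄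

lemma isCardinalAccessible_cellFunctor (κ : Cardinal.{v}) [Fact κ.IsRegular]
    [∀ t, IsCardinalPresentable (A t) κ] : (cellFunctor f).IsCardinalAccessible κ := by
  have h : ∀ B : T → C, (∐ fun t => coyoneda.obj (Opposite.op (A t)) ⋙
      sigmaConst.{v}.obj (B t) : C ⥤ C).IsCardinalAccessible κ := fun B =>
    isCardinalAccessible_of_isColimit (colimit.isColimit _) (fun ⟨t⟩ => by
      dsimp
      infer_instance)
  refine isCardinalAccessible_of_isColimit (colimit.isColimit (span _ _)) ?_
  rintro (_ | _ | _)
  · exact h _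
  · exact inferInstanceAs ((𝟭 C).IsCardinalAccessible κ)
  · exact h _

end OneStep

open SmallObject in
lemma isCardinalAccessible_iterationFunctor_obj [HasColimits C] {F : C ⥤ C} (ε : 𝟭 C ⟶ F)
    (κ : Cardinal.{v}) [Fact κ.IsRegular] [F.IsCardinalAccessible κ]
    (J : Type v) [LinearOrder J] [OrderBot J] [SuccOrder J] [WellFoundedLT J] (j : J) :
    (((SuccStruct.ofNatTrans ε).iterationFunctor J).obj j).IsCardinalAccessible κ := by
  let G := (SuccStruct.ofNatTrans ε).iterationFunctor J
  change (G.obj j).IsCardinalAccessible κ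
  induction j using SuccOrder.limitRecOn with
  | isMin j hj =>
    obtain rfl := hj.eq_bot
    have : (SuccStruct.ofNatTrans ε).X₀.IsCardinalAccessible κ :=
      inferInstanceAs ((𝟭 C).IsCardinalAccessible κ)
    exact Functor.isCardinalAccessible_of_natIso
      ((SuccStruct.ofNatTrans ε).iterationFunctorObjBotIso J).symm κ
  | succ j hj hj' =>
    have : ((SuccStruct.ofNatTrans ε).succ (G.obj j)).IsCardinalAccessible κ :=
      inferInstanceAs ((G.obj j ⋙ F).IsCardinalAccessible κ)
    exact Functor.isCardinalAccessible_of_natIso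
      ((SuccStruct.ofNatTrans ε).iterationFunctorObjSuccIso j hj).symm κ
  | isSuccLimit j hj hj' =>
    exact isCardinalAccessible_of_isColimit (G.isColimitOfIsWellOrderContinuous j hj)
      (fun ⟨k, hk⟩ => hj' k hk)

open SmallObject in
/-- The fibrant replacement functor obtained from the small object argument is accessible. -/
lemma exists_accessible_fibrant_replacement [LocallyPresentable C] (Λ : Set (Arrow C))
    [Small.{v} Λ] :
    ∃ (F : C ⥤ C) (η : 𝟭 C ⟶ F) (κ : Cardinal.{v}) (_ : Fact κ.IsRegular),
      F.IsCardinalAccessible κ ∧ ∀ X, llp (rlp (ofArrows Λ)) (η.app X) ∧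
        IsFibrantObj (llp (rlp (ofArrows Λ))) (F.obj X) := by
  let T := Shrink.{v} Λ
  let e : T ≃ Λ := (equivShrink Λ).symm
  obtain ⟨κ, _, _, _, h⟩ := LocallyPresentable.exists_cardinal_forall (C := C) 0
    (fun t : T => (e t).1.left)
  let f := fun t : T => (e t).1.hom
  have hne : κ.ord ≠ 0 := by
    simpa using (Fact.out : κ.IsRegular).ne_zero
  have : Nonempty κ.ord.ToType := Ordinal.nonempty_toType_iff.2 hne
  let _ : OrderBot κ.ord.ToType := WellFoundedLT.toOrderBot _
  let _ : SuccOrder κ.ord.ToType := SuccOrder.ofLinearWellFoundedLT _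
  have : NoMaxOrder κ.ord.ToType := Cardinal.noMaxOrder (Fact.out : κ.IsRegular).aleph0_le
  have := isCardinalAccessible_cellFunctor f κ
  let J := κ.ord.ToType
  let Φ := SuccStruct.ofNatTrans (cellIncl f)
  let W := (ofArrows Λ).rlp.llp
  refine ⟨Φ.iteration J, Φ.ιIteration J, κ, inferInstance, ?_, fun X => ⟨?_, ?_⟩⟩
  · exact isCardinalAccessible_of_isColimit (Φ.isColimitIterationCocone J)
      (isCardinalAccessible_iterationFunctor_obj _ κ J)
  · have hΦ : Φ.prop ≤ W.functorCategory C := by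
      rintro _ _ _ ⟨⟩ X
      exact cellIncl_mem (W := W) f (fun t => MorphismProperty.le_llp_rlp _ _ (e t).2) _
    have hW : W.functorCategory C (Φ.ιIteration J) :=
      MorphismProperty.transfiniteCompositionsOfShape_le _ J _
        ⟨(Φ.transfiniteCompositionOfShapeιIteration J).ofLE hΦ⟩
    rw [rlp_eq, llp_eq]
    exact hW X
  · refine IsFibrantObj.of_generators ?_
    intro A B g hg a
    obtain ⟨t, ht⟩ : ∃ t : T, (e t).1 = Arrow.mk g := ⟨e.symm ⟨_, hg⟩, by simp⟩
    have hA : IsCardinalPresentable A κ := by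
      have := h t
      rw [ht] at this
      exact this
    obtain ⟨j, a', ha'⟩ := IsCardinalPresentable.exists_hom_of_isColimit κ
      (isColimitOfPreserves ((evaluation C C).obj X) (Φ.isColimitIterationCocone J)) a
    obtain ⟨b, hb⟩ : ∃ b : B ⟶ (cellFunctor f).obj (((Φ.iterationFunctor J).obj j).obj X),
        g ≫ b = a' ≫ (cellIncl f).app _ := by
      have h' := exists_extend_cellIncl f (X := ((Φ.iterationFunctor J).obj j).obj X) t
      have h'' : ∀ (γ : Arrow C), (∀ a : γ.left ⟶ ((Φ.iterationFunctor J).obj j).obj X,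
          ∃ b, γ.hom ≫ b = a ≫ (cellIncl f).app _) → γ = Arrow.mk g →
          ∃ b, g ≫ b = a' ≫ (cellIncl f).app _ := by
        rintro _ h rfl
        exact h a'
      exact h'' (e t).1 h' ht
    let s : ((Φ.iterationFunctor J).obj j ⋙ cellFunctor f) ⟶
        (Φ.iterationFunctor J).obj (Order.succ j) :=
      (Φ.iterationFunctorObjSuccIso j (not_isMax j)).inv
    let ι (k : J) : (Φ.iterationFunctor J).obj k ⟶ Φ.iteration J :=
      (Φ.iterationCocone J).ι.app k
    have hs : (Functor.whiskerLeft ((Φ.iterationFunctor J).obj j) (cellIncl f)) ≫ s ≫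
        ι (Order.succ j) = ι j :=
      (Φ.iterationFunctor_map_succ_assoc j (not_isMax j) _).symm.trans
        ((Φ.iterationCocone J).w (homOfLE (Order.le_succ j)))
    refine ⟨b ≫ s.app X ≫ (ι _).app X, ?_⟩
    have hs' := congr_app hs X
    rw [reassoc_of% hb, ← ha']
    exact a' ≫= hs'

section Approximation

universe u'

variable {D : Type u'} [Category.{v} D] (κ : Cardinal.{v}) [Fact κ.IsRegular]
  {N : Type v} (G H : N → D ⥤ C) [∀ n, (G n).IsCardinalAccessible κ]
  [∀ n, (H n).IsCardinalAccessible κ]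

/-- Given a filtered diagram `F` and a cocone `c` over it, conditions ensuring that morphisms
`(G n).obj c.pt ⟶ (H n).obj c.pt` lift to the colimit of `F`. -/
lemma exists_lift_to_colimit {T : Type v} [SmallCategory T] [CategoryTheory.IsCardinalFiltered T κ]
    {F : T ⥤ D} {c' : Cocone F} (hc' : IsColimit c') (c : Cocone F)
    [∀ n t, IsCardinalPresentable ((G n).obj (F.obj t)) κ]
    (φ : ∀ n, (G n).obj c.pt ⟶ (H n).obj c.pt)
    (hφ : ∀ n s, ∃ (t : T) (ψ : (G n).obj (F.obj s) ⟶ (H n).obj (F.obj t)),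
      ψ ≫ (H n).map (c.ι.app t) = (G n).map (c.ι.app s) ≫ φ n)
    (hc : ∀ m n s t (x y : (G m).obj (F.obj s) ⟶ (H n).obj (F.obj t)),
      x ≫ (H n).map (c.ι.app t) = y ≫ (H n).map (c.ι.app t) →
        ∃ (t' : T) (w : t ⟶ t'), x ≫ (H n).map (F.map w) = y ≫ (H n).map (F.map w)) :
    ∃ φ' : ∀ n, (G n).obj c'.pt ⟶ (H n).obj c'.pt,
      (∀ n, φ' n ≫ (H n).map (hc'.desc c) = (G n).map (hc'.desc c) ≫ φ n) ∧
      ∀ m n (x y : (G m).obj c'.pt ⟶ (H n).obj c'.pt),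
        x ≫ (H n).map (hc'.desc c) = y ≫ (H n).map (hc'.desc c) → x = y := by
  have := isFiltered_of_isCardinalFiltered T κ
  have hG (n) := Functor.preservesColimitsOfShape_of_isCardinalAccessible (G n) κ T
  have hH (n) := Functor.preservesColimitsOfShape_of_isCardinalAccessible (H n) κ T
  have key : ∀ m n s (x y : (G m).obj (F.obj s) ⟶ (H n).obj c'.pt),
      x ≫ (H n).map (hc'.desc c) = y ≫ (H n).map (hc'.desc c) → x = y := by
    intro m n s x y hxy
    have lift (z : (G m).obj (F.obj s) ⟶ (H n).obj c'.pt) : ∃ (t : T)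
        (z' : (G m).obj (F.obj s) ⟶ (H n).obj (F.obj t)), z' ≫ (H n).map (c'.ι.app t) = z :=
      IsCardinalPresentable.exists_hom_of_isColimit κ (isColimitOfPreserves (H n) hc') z
    obtain ⟨t₁, x, rfl⟩ := lift x
    obtain ⟨t₂, y, rfl⟩ := lift y
    simp only [Category.assoc, ← Functor.map_comp, hc'.fac] at hxy
    obtain ⟨t, w, h⟩ := hc m n s (IsFiltered.max t₁ t₂)
      (x ≫ (H n).map (F.map (IsFiltered.leftToMax t₁ t₂)))
      (y ≫ (H n).map (F.map (IsFiltered.rightToMax t₁ t₂)))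
      (by simpa only [Category.assoc, ← Functor.map_comp, c.w] using hxy)
    have h' := h =≫ (H n).map (c'.ι.app t)
    simpa only [Category.assoc, ← Functor.map_comp, c'.w] using h'
  choose t ψ hψ using hφ
  let φ' (n) : (G n).obj c'.pt ⟶ (H n).obj c'.pt :=
    (isColimitOfPreserves (G n) hc').desc
      { pt := (H n).obj c'.pt
        ι :=
          { app s := ψ n s ≫ (H n).map (c'.ι.app (t n s))
            naturality s₁ s₂ w := by
              dsimp
              rw [Category.comp_id]
              refine key _ _ _ _ _ ?_
              simp only [Category.assoc, ← Functor.map_comp, hc'.fac, hψ]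
              rw [← (G n).map_comp_assoc, c.w] } }
  have hφ' (n s) : (G n).map (c'.ι.app s) ≫ φ' n = ψ n s ≫ (H n).map (c'.ι.app (t n s)) :=
    (isColimitOfPreserves (G n) hc').fac _ s
  refine ⟨φ', fun n => (isColimitOfPreserves (G n) hc').hom_ext fun s => ?_,
    fun m n x y hxy => (isColimitOfPreserves (G m) hc').hom_ext fun s => key _ _ _ _ _ ?_⟩
  · dsimp
    rw [reassoc_of% hφ', ← Functor.map_comp, hc'.fac, hψ, ← Functor.map_comp_assoc, hc'.fac]
  · simp only [Category.assoc, hxy]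

/-- Trees built from binary operations indexed by `Ω` and operations of arity `< κ`. -/
inductive Tree (Ω : Type v) (κ : Cardinal.{v}) : Type v
  | op (ω : Ω) (a b : Tree Ω κ) : Tree Ω κ
  | sup (s : Set κ.out) (hs : Cardinal.mk s < κ) (f : s → Tree Ω κ) : Tree Ω κ

lemma Tree.exists_map (Ω : Type v) (J : Type v) [PartialOrder J]
    [CategoryTheory.IsCardinalFiltered J κ] (r : Ω → J → J → J → Prop)
    (hr : ∀ ω a b, ∃ c, r ω a b c) :
    ∃ g : Tree Ω κ → J, (∀ ω a b, r ω (g a) (g b) (g (.op ω a b))) ∧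
      ∀ s hs f i, g (f i) ≤ g (.sup s hs f) := by
  choose ops hops using hr
  have hsup : ∀ (s : Set κ.out) (_ : Cardinal.mk s < κ) (f : s → J), ∃ j, ∀ i, f i ≤ j :=
    fun s hs f => ⟨IsCardinalFiltered.max f ((hasCardinalLT_iff_cardinal_mk_lt _ _).2 hs),
      fun i => leOfHom (IsCardinalFiltered.toMax f _ i)⟩
  choose sup hsup using hsup
  let g : Tree Ω κ → J := Tree.rec (fun ω _ _ a b => ops ω a b) (fun s hs _ f => sup s hs f)
  exact ⟨g, fun ω a b => hops ω (g a) (g b), fun s hs f i => hsup s hs (fun i => g (f i)) i⟩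

lemma Tree.isCardinalFiltered (Ω : Type v) [Preorder (Tree Ω κ)]
    (h : ∀ s hs f i, f i ≤ Tree.sup (Ω := Ω) (κ := κ) s hs f) :
    CategoryTheory.IsCardinalFiltered (Tree Ω κ) κ := by
  refine isCardinalFiltered_preorder _ _ fun K f hK => ?_
  obtain ⟨s, hs⟩ := Cardinal.le_mk_iff_exists_set.1
    (show Cardinal.mk K ≤ Cardinal.mk κ.out by simpa using hK.le)
  obtain ⟨e⟩ := Cardinal.eq.1 hs
  exact ⟨.sup s (hs.trans_lt hK) (f ∘ e), fun k => by
    simpa using h s (hs.trans_lt hK) (f ∘ e) (e.symm k)⟩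

lemma exists_small_approximation {Q : Type v} [SmallCategory Q] (ι : Q ⥤ D) [HasColimits D]
    [∀ n q, IsCardinalPresentable ((G n).obj (ι.obj q)) κ] :
    ∃ (K : Type v) (E : K → D), ∀ (J : Type v) [PartialOrder J]
      [CategoryTheory.IsCardinalFiltered J κ] (Z : J ⥤ Q) (c : Cocone (Z ⋙ ι)) (_ : IsColimit c)
      (φ : ∀ n, (G n).obj c.pt ⟶ (H n).obj c.pt),
      ∃ (k : K) (e : E k ⟶ c.pt) (φ' : ∀ n, (G n).obj (E k) ⟶ (H n).obj (E k)),
        (∀ n, φ' n ≫ (H n).map e = (G n).map e ≫ φ n) ∧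
        ∀ m n (x y : (G m).obj (E k) ⟶ (H n).obj (E k)),
          x ≫ (H n).map e = y ≫ (H n).map e → x = y := by
  let P := Σ (m n : N) (q q' : Q), ((G m).obj (ι.obj q) ⟶ (H n).obj (ι.obj q')) ×
    ((G m).obj (ι.obj q) ⟶ (H n).obj (ι.obj q'))
  let Ω := N ⊕ P
  let T := Tree Ω κ
  refine ⟨Σ (p : Preorder T), letI := p.smallCategory; T ⥤ Q,
    fun ⟨p, F⟩ => letI := p.smallCategory; colimit (F ⋙ ι), ?_⟩
  intro J _ _ Z c hc φ
  have := isFiltered_of_isCardinalFiltered J κ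
  have hH (n) := Functor.preservesColimitsOfShape_of_isCardinalAccessible (H n) κ J
  have hl (n : N) (j : J) : ∃ (t : J) (_ : j ≤ t) (ψ : (G n).obj (ι.obj (Z.obj j)) ⟶
      (H n).obj (ι.obj (Z.obj t))),
      ψ ≫ (H n).map (c.ι.app t) = (G n).map (c.ι.app j) ≫ φ n := by
    obtain ⟨t, ψ, h⟩ := IsCardinalPresentable.exists_hom_of_isColimit κ
      (X := (G n).obj (ι.obj (Z.obj j))) (isColimitOfPreserves (H n) hc)
      ((G n).map (c.ι.app j) ≫ φ n)
    refine ⟨IsFiltered.max j t, leOfHom (IsFiltered.leftToMax _ _),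
      ψ ≫ (H n).map (ι.map (Z.map (IsFiltered.rightToMax j t))), ?_⟩
    have hw := c.w (IsFiltered.rightToMax j t)
    dsimp at h hw ⊢
    rw [Category.assoc, ← Functor.map_comp, hw]
    exact h
  have he (ω : P) (i j : J) : ∃ (t : J) (h : j ≤ t),
      ∀ x y : (G ω.1).obj (ι.obj (Z.obj i)) ⟶ (H ω.2.1).obj (ι.obj (Z.obj j)),
        Z.obj i = ω.2.2.1 → Z.obj j = ω.2.2.2.1 → HEq x ω.2.2.2.2.1 → HEq y ω.2.2.2.2.2 →
        x ≫ (H ω.2.1).map (c.ι.app j) = y ≫ (H ω.2.1).map (c.ι.app j) →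
        x ≫ (H ω.2.1).map (ι.map (Z.map (homOfLE h))) =
          y ≫ (H ω.2.1).map (ι.map (Z.map (homOfLE h))) := by
    by_cases hω : ∃ x y : (G ω.1).obj (ι.obj (Z.obj i)) ⟶ (H ω.2.1).obj (ι.obj (Z.obj j)),
        HEq x ω.2.2.2.2.1 ∧ HEq y ω.2.2.2.2.2 ∧
        x ≫ (H ω.2.1).map (c.ι.app j) = y ≫ (H ω.2.1).map (c.ι.app j)
    · obtain ⟨x, y, hx, hy, hxy⟩ := hω
      obtain ⟨t, u, h⟩ := IsCardinalPresentable.exists_eq_of_isColimit' κ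
        (isColimitOfPreserves (H ω.2.1) hc) x y hxy
      refine ⟨t, leOfHom u, fun x' y' _ _ hx' hy' _ => ?_⟩
      obtain rfl := eq_of_heq (hx'.trans hx.symm)
      obtain rfl := eq_of_heq (hy'.trans hy.symm)
      exact h
    · exact ⟨j, le_rfl, fun x y _ _ hx hy hxy => (hω ⟨x, y, hx, hy, hxy⟩).elim⟩
  obtain ⟨g, hg, hg'⟩ := Tree.exists_map κ Ω J (fun ω i j t => match ω with
    | .inl n => ∃ (_ : i ≤ t) (ψ : (G n).obj (ι.obj (Z.obj i)) ⟶ (H n).obj (ι.obj (Z.obj t))),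
        ψ ≫ (H n).map (c.ι.app t) = (G n).map (c.ι.app i) ≫ φ n
    | .inr ω => ∃ (h : j ≤ t),
      ∀ x y : (G ω.1).obj (ι.obj (Z.obj i)) ⟶ (H ω.2.1).obj (ι.obj (Z.obj j)),
        Z.obj i = ω.2.2.1 → Z.obj j = ω.2.2.2.1 → HEq x ω.2.2.2.2.1 → HEq y ω.2.2.2.2.2 →
        x ≫ (H ω.2.1).map (c.ι.app j) = y ≫ (H ω.2.1).map (c.ι.app j) →
        x ≫ (H ω.2.1).map (ι.map (Z.map (homOfLE h))) =
          y ≫ (H ω.2.1).map (ι.map (Z.map (homOfLE h)))) (by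
    rintro (n | ω) i j
    · exact hl n i
    · exact he ω i j)
  let p : Preorder T := Preorder.lift g
  have hT : CategoryTheory.IsCardinalFiltered T κ := Tree.isCardinalFiltered κ Ω hg'
  have hgm : Monotone g := fun _ _ h => h
  let F : T ⥤ Q := hgm.functor ⋙ Z
  have hF (n t) : IsCardinalPresentable ((G n).obj ((F ⋙ ι).obj t)) κ :=
    inferInstanceAs (IsCardinalPresentable ((G n).obj (ι.obj (F.obj t))) κ)
  obtain ⟨φ', h₁, h₂⟩ := exists_lift_to_colimit κ G H (F := F ⋙ ι) (colimit.isColimit _)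
    (Cocone.whisker hgm.functor c) φ (by
      intro n s
      obtain ⟨_, ψ, hψ⟩ := hg (.inl n) s s
      exact ⟨_, ψ, hψ⟩) (by
      intro m n s t x y hxy
      obtain ⟨h, hh⟩ := hg (.inr ⟨m, n, _, _, x, y⟩) s t
      exact ⟨_, homOfLE h, hh x y rfl rfl HEq.rfl HEq.rfl hxy⟩)
  exact ⟨⟨p, F⟩, _, φ', h₁, h₂⟩

end Approximation

/-- There are arbitrarily large regular cardinals `κ` such that a given cocontinuous functor
preserves `κ`-presentable objects. -/
lemma LocallyPresentable.exists_cardinal_preserving [LocallyPresentable C] (κ₀ : Cardinal.{v})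
    {T : Type v} (G : T → C) (I : C ⥤ C) [PreservesColimits I] :
    ∃ (κ : Cardinal.{v}) (_ : Fact κ.IsRegular), κ₀ ≤ κ ∧ IsCardinalLocallyPresentable C κ ∧
      (∀ t, IsCardinalPresentable (G t) κ) ∧
      ∀ X : C, IsCardinalPresentable X κ → IsCardinalPresentable (I.obj X) κ := by
  obtain ⟨κ₁, _, _⟩ := LocallyPresentable.exists_isCardinalLocallyPresentable C
  obtain ⟨P, _, hP, hP'⟩ :=
    (IsCardinalLocallyPresentable.iff_exists_isStrongGenerator C κ₁).1 inferInstance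
  obtain ⟨κ, _, h₀, h₁, h₂⟩ := LocallyPresentable.exists_cardinal_forall (C := C) (max κ₀ κ₁)
    (Sum.elim G fun p : Shrink.{v} (Subtype P) => I.obj ((equivShrink _).symm p).1)
  refine ⟨κ, inferInstance, (le_max_left _ _).trans h₀, h₁, fun t => h₂ (.inl t), ?_⟩
  intro X hX
  have hP'' := hP'.trans (isCardinalPresentable_monotone C ((le_max_right _ _).trans h₀))
  rw [← isCardinalPresentable_iff,
    IsStrongGenerator.colimitsCardinalClosure_eq_isCardinalPresentable hP hP''] at hX
  rw [← isCardinalPresentable_iff]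
  refine P.colimitsCardinalClosure_le κ (Q := (isCardinalPresentable C κ).inverseImage I)
    (fun J _ hJ => ?_) (fun Y hY => ?_) X hX
  · have := isClosedUnderColimitsOfShape_isCardinalPresentable C hJ
    infer_instance
  · have := h₂ (.inr (equivShrink _ ⟨Y, hY⟩))
    simpa [isCardinalPresentable_iff] using this

lemma exists_dense_functor (C : Type u) [Category.{v} C] (κ : Cardinal.{v}) [Fact κ.IsRegular]
    [IsCardinalLocallyPresentable C κ] :
    ∃ (Q : Type v) (_ : SmallCategory Q) (ι : Q ⥤ C),
      (∀ q, IsCardinalPresentable (ι.obj q) κ) ∧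
      ∀ X, ∃ (J : Type v) (_ : SmallCategory J) (_ : CategoryTheory.IsCardinalFiltered J κ)
        (Z : J ⥤ Q) (c : Z ⋙ ι ⟶ (Functor.const J).obj X),
        Nonempty (IsColimit (Cocone.mk X c)) := by
  obtain ⟨P, _, hP⟩ := HasCardinalFilteredGenerator.exists_small_generator C κ
  let e := equivSmallModel.{v} P.FullSubcategory
  refine ⟨SmallModel.{v} P.FullSubcategory, inferInstance, e.inverse ⋙ P.ι,
    fun q => hP.le_isCardinalPresentable _ (e.inverse.obj q).2, fun X => ?_⟩
  obtain ⟨J, _, _, ⟨p⟩⟩ := hP.exists_colimitsOfShape X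
  let F : J ⥤ P.FullSubcategory := P.lift p.diag p.prop_diag_obj
  let α : (F ⋙ e.functor) ⋙ e.inverse ⋙ P.ι ≅ p.diag :=
    Functor.isoWhiskerLeft F (Functor.isoWhiskerRight e.unitIso.symm P.ι)
  exact ⟨J, inferInstance, inferInstance, F ⋙ e.functor, α.hom ≫ p.ι,
    ⟨(IsColimit.precomposeHomEquiv α _).symm p.isColimit⟩⟩

section Prod

universe u'

variable {D : Type u'} [Category.{v} D] {J : Type v} [SmallCategory J]

/-- A cocone in a product category is colimit if its components are. -/
def isColimitProd {F : J ⥤ C × D} {c : Cocone F}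
    (h₁ : IsColimit ((CategoryTheory.Prod.fst C D).mapCocone c))
    (h₂ : IsColimit ((CategoryTheory.Prod.snd C D).mapCocone c)) :
    IsColimit c where
  desc s := (h₁.desc ((CategoryTheory.Prod.fst C D).mapCocone s),
    h₂.desc ((CategoryTheory.Prod.snd C D).mapCocone s))
  fac s j := Prod.ext (h₁.fac ((CategoryTheory.Prod.fst C D).mapCocone s) j)
    (h₂.fac ((CategoryTheory.Prod.snd C D).mapCocone s) j)
  uniq s m hm := Prod.ext
    (h₁.uniq ((CategoryTheory.Prod.fst C D).mapCocone s) m.1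
      fun j => congrArg _root_.Prod.fst (hm j))
    (h₂.uniq ((CategoryTheory.Prod.snd C D).mapCocone s) m.2
      fun j => congrArg _root_.Prod.snd (hm j))

/-- The cocone in a product category with given components. -/
@[simps]
def coconeProd {F : J ⥤ C × D} (c₁ : Cocone (F ⋙ CategoryTheory.Prod.fst C D))
    (c₂ : Cocone (F ⋙ CategoryTheory.Prod.snd C D)) : Cocone F where
  pt := (c₁.pt, c₂.pt)
  ι :=
    { app j := (c₁.ι.app j, c₂.ι.app j)
      naturality _ _ f := Prod.ext (c₁.ι.naturality f) (c₂.ι.naturality f) }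

/-- The cocone with given colimit components is colimit. -/
def isColimitCoconeProd {F : J ⥤ C × D} {c₁ : Cocone (F ⋙ CategoryTheory.Prod.fst C D)}
    {c₂ : Cocone (F ⋙ CategoryTheory.Prod.snd C D)} (h₁ : IsColimit c₁) (h₂ : IsColimit c₂) :
    IsColimit (coconeProd c₁ c₂) :=
  isColimitProd h₁ h₂

variable [HasColimits C] [HasColimits D]

instance hasColimits_prod : HasColimits (C × D) where
  has_colimits_of_shape _ _ :=
    { has_colimit F := ⟨_, isColimitCoconeProd
        (colimit.isColimit (F ⋙ CategoryTheory.Prod.fst C D))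
        (colimit.isColimit (F ⋙ CategoryTheory.Prod.snd C D))⟩ }

instance preservesColimits_fst : PreservesColimits (CategoryTheory.Prod.fst C D) where
  preservesColimitsOfShape :=
    { preservesColimit {F} := preservesColimit_of_preserves_colimit_cocone
        (isColimitCoconeProd (colimit.isColimit (F ⋙ CategoryTheory.Prod.fst C D))
          (colimit.isColimit (F ⋙ CategoryTheory.Prod.snd C D)))
        (colimit.isColimit (F ⋙ CategoryTheory.Prod.fst C D)) }

instance preservesColimits_snd : PreservesColimits (CategoryTheory.Prod.snd C D) where
  preservesColimitsOfShape :=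
    { preservesColimit {F} := preservesColimit_of_preserves_colimit_cocone
        (isColimitCoconeProd (colimit.isColimit (F ⋙ CategoryTheory.Prod.fst C D))
          (colimit.isColimit (F ⋙ CategoryTheory.Prod.snd C D)))
        (colimit.isColimit (F ⋙ CategoryTheory.Prod.snd C D)) }

end Prod

lemma exists_directed_presentation_prod {Q : Type v} [SmallCategory Q] {ι : Q ⥤ C}
    (κ : Cardinal.{v}) [Fact κ.IsRegular]
    (hι : ∀ X, ∃ (J : Type v) (_ : SmallCategory J) (_ : CategoryTheory.IsCardinalFiltered J κ)
        (Z : J ⥤ Q) (c : Z ⋙ ι ⟶ (Functor.const J).obj X),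
        Nonempty (IsColimit (Cocone.mk X c))) (X Y : C) :
    ∃ (J : Type v) (_ : PartialOrder J) (_ : CategoryTheory.IsCardinalFiltered J κ)
      (Z : J ⥤ Q × Q) (c : Z ⋙ ι.prod ι ⟶ (Functor.const J).obj (X, Y)),
        Nonempty (IsColimit (Cocone.mk (X, Y) c)) := by
  obtain ⟨J₁, _, _, Z₁, c₁, ⟨h₁⟩⟩ := hι X
  obtain ⟨J₂, _, _, Z₂, c₂, ⟨h₂⟩⟩ := hι Y
  have := isFiltered_of_isCardinalFiltered J₁ κ
  have := isFiltered_of_isCardinalFiltered J₂ κ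
  obtain ⟨J, _, _, F, _⟩ := IsCardinalFiltered.exists_cardinal_directed (J₁ × J₂) κ
  let F₁ := F ⋙ CategoryTheory.Prod.fst _ _
  let F₂ := F ⋙ CategoryTheory.Prod.snd _ _
  refine ⟨J, inferInstance, inferInstance, (F₁ ⋙ Z₁).prod' (F₂ ⋙ Z₂),
    { app j := (c₁.app (F₁.obj j), c₂.app (F₂.obj j))
      naturality _ _ f := Prod.ext (c₁.naturality (F₁.map f)) (c₂.naturality (F₂.map f)) },
    ⟨isColimitProd ((Functor.Final.isColimitWhiskerEquiv F₁ _).symm h₁)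
      ((Functor.Final.isColimitWhiskerEquiv F₂ _).symm h₂)⟩⟩

section SolutionSet

variable {E : Cylinder C} {L An : MorphismProperty C}

lemma isWeakEq_iff_exists_homotopy [HasColimits C] (hE : IsExactCylinder E L)
    (hAn : IsRightAnodyneClass E L An) {F : C ⥤ C} {η : 𝟭 C ⟶ F} (hη : ∀ X, An (η.app X))
    (hF : ∀ X, IsFibrantObj An (F.obj X)) {X Y : C} (f : X ⟶ Y) :
    IsWeakEq E An f ↔ ∃ r : Y ⟶ F.obj X, E.Homotopy (f ≫ r) (η.app X) ∧
      E.Homotopy (r ≫ F.map f) (η.app Y) := by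
  constructor
  · intro hf
    obtain ⟨q, hq⟩ := (hf _ (hF X)).2 (Quot.mk _ (η.app X))
    obtain ⟨r, rfl⟩ := Quot.exists_rep q
    have h₁ : E.Homotopy (f ≫ r) (η.app X) := homotopy_of_quot_mk_eq hE hAn (hF X) hq
    refine ⟨r, h₁, homotopy_of_quot_mk_eq hE hAn (hF Y) ((hf _ (hF Y)).1 ?_)⟩
    have h₂ := h₁.postcomp (F.map f)
    have h₃ : η.app X ≫ F.map f = f ≫ η.app Y := (η.naturality f).symm
    rw [h₃, Category.assoc] at h₂
    exact Quot.sound h₂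
  · rintro ⟨r, h₁, h₂⟩
    have key {Z T : C} {g g' : Z ⟶ T} (h : E.Homotopy g g') (hg : IsWeakEq E An g') :
        IsWeakEq E An g := fun W hW => by
      rw [h.precompQ_eq]
      exact hg W hW
    exact (key h₁ (hAn.isWeakEq hE (hη X))).of_comp_comp (key h₂ (hAn.isWeakEq hE (hη Y)))

lemma preservesColimitsOfShape_const {D : Type*} [Category* D] (J : Type*) [Category* J]
    [IsConnected J] (X : C) : PreservesColimitsOfShape J ((Functor.const D).obj X) where
  preservesColimit {_} :=
    { preserves {_} _ := ⟨(isColimitConstCocone J X).ofIsoColimit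
        (Cocone.ext (Iso.refl _) (fun _ => Category.comp_id _))⟩ }

/-- The names of the morphisms witnessing that a commutative square has a weak equivalence
as target. -/
inductive Witness : Type v
  | map | inv | unit | counit | source | target

namespace Witness

variable (A B : C) (I F : C ⥤ C)

/-- The source of a witness. -/
def dom : Witness.{v} → C × C ⥤ C
  | map => CategoryTheory.Prod.fst C C
  | inv => CategoryTheory.Prod.snd C C
  | unit => CategoryTheory.Prod.fst C C ⋙ I
  | counit => CategoryTheory.Prod.snd C C ⋙ I
  | source => (Functor.const _).obj A
  | target => (Functor.const _).obj B

/-- The target of a witness. -/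
def cod : Witness.{v} → C × C ⥤ C
  | map => CategoryTheory.Prod.snd C C
  | inv => CategoryTheory.Prod.fst C C ⋙ F
  | unit => CategoryTheory.Prod.fst C C ⋙ F
  | counit => CategoryTheory.Prod.snd C C ⋙ F
  | source => CategoryTheory.Prod.fst C C
  | target => CategoryTheory.Prod.snd C C

variable [HasColimits C] (κ : Cardinal.{v}) [Fact κ.IsRegular]

instance isCardinalAccessible_fst : (CategoryTheory.Prod.fst C C).IsCardinalAccessible κ where

instance isCardinalAccessible_snd : (CategoryTheory.Prod.snd C C).IsCardinalAccessible κ where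

lemma isCardinalAccessible_dom [PreservesColimits I] (n : Witness.{v}) :
    (dom A B I n).IsCardinalAccessible κ := by
  have : I.IsCardinalAccessible κ := { }
  have h (X : C) : ((Functor.const (C × C)).obj X).IsCardinalAccessible κ :=
    { preservesColimitOfShape J _ _ := by
        have := isFiltered_of_isCardinalFiltered J κ
        have := IsFiltered.isConnected J
        exact preservesColimitsOfShape_const J X }
  cases n <;> first | exact h _ | (dsimp only [dom]; infer_instance)

lemma isCardinalAccessible_cod [F.IsCardinalAccessible κ] (n : Witness.{v}) :
    (cod F n).IsCardinalAccessible κ := by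
  cases n <;> (dsimp only [cod]; infer_instance)

end Witness

/-- Squares from a fixed morphism to weak equivalences factor through a small family of weak
equivalences. -/
lemma exists_solution_set [LocallyPresentable C] (hE : IsExactCylinder E L)
    (hAn : IsRightAnodyneClass E L An) {A B : C} (i : A ⟶ B) :
    ∃ (K : Type v) (w : K → Arrow C), (∀ k, IsWeakEq E An (w k).hom) ∧
      ∀ ⦃X Y : C⦄ (f : X ⟶ Y) (a : A ⟶ X) (b : B ⟶ Y), IsWeakEq E An f → a ≫ f = i ≫ b →
        ∃ (k : K) (a' : A ⟶ (w k).left) (b' : B ⟶ (w k).right) (e₁ : (w k).left ⟶ X)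
          (e₂ : (w k).right ⟶ Y), a' ≫ (w k).hom = i ≫ b' ∧ (w k).hom ≫ e₂ = e₁ ≫ f ∧
            a' ≫ e₁ = a ∧ b' ≫ e₂ = b := by
  obtain ⟨Λ, _, -, hΛ⟩ := hAn.exists_generating_set
  obtain ⟨F, η, κ₀, _, _, hF⟩ := exists_accessible_fibrant_replacement Λ
  rw [← hΛ] at hF
  have := hE.preservesColimits
  obtain ⟨κ, _, hκ, _, hAB, hI⟩ := LocallyPresentable.exists_cardinal_preserving κ₀
    (fun t : ULift.{v} Bool => if t.down then A else B) E.I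
  have hA : IsCardinalPresentable A κ := hAB ⟨true⟩
  have hB : IsCardinalPresentable B κ := hAB ⟨false⟩
  have hFκ : F.IsCardinalAccessible κ := F.isCardinalAccessible_of_le hκ
  obtain ⟨Q, _, ι, hι, hQ⟩ := exists_dense_functor C κ
  have h₁ := Witness.isCardinalAccessible_dom A B E.I κ
  have h₂ := Witness.isCardinalAccessible_cod F κ
  have h₃ (n q) : IsCardinalPresentable ((Witness.dom A B E.I n).obj ((ι.prod ι).obj q)) κ := by
    cases n
    · exact hι _
    · exact hι _
    · exact hI _ (hι _)
    · exact hI _ (hι _)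
    · exact hA
    · exact hB
  obtain ⟨K, Z, hZ⟩ := exists_small_approximation κ (Witness.dom A B E.I) (Witness.cod F)
    (ι.prod ι)
  refine ⟨Σ k : K, { g : (Z k).1 ⟶ (Z k).2 // IsWeakEq E An g }, fun k => Arrow.mk k.2.1,
    fun k => k.2.2, ?_⟩
  intro X Y f a b hf sq
  obtain ⟨r, hr, hr'⟩ := (isWeakEq_iff_exists_homotopy hE hAn (fun X => (hF X).1)
    (fun X => (hF X).2) f).1 hf
  obtain ⟨h, hh₀, hh₁⟩ := E.homotopy_iff.1 hr
  obtain ⟨k, hk₀, hk₁⟩ := E.homotopy_iff.1 hr'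
  obtain ⟨J, _, _, D, c, ⟨hc⟩⟩ := exists_directed_presentation_prod κ hQ X Y
  obtain ⟨z, e, φ, hφ, inj⟩ := hZ J D _ hc (fun
    | .map => f
    | .inv => r
    | .unit => h
    | .counit => k
    | .source => a
    | .target => b)
  let f' : (Z z).1 ⟶ (Z z).2 := φ .map
  let r' : (Z z).2 ⟶ F.obj (Z z).1 := φ .inv
  let h' : E.I.obj (Z z).1 ⟶ F.obj (Z z).1 := φ .unit
  let k' : E.I.obj (Z z).2 ⟶ F.obj (Z z).2 := φ .counit
  let a' : A ⟶ (Z z).1 := φ .source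
  let b' : B ⟶ (Z z).2 := φ .target
  let e₁ : (Z z).1 ⟶ X := e.1
  let e₂ : (Z z).2 ⟶ Y := e.2
  have hf' : f' ≫ e₂ = e₁ ≫ f := hφ .map
  have hr' : r' ≫ F.map e₁ = e₂ ≫ r := hφ .inv
  have hh' : h' ≫ F.map e₁ = E.I.map e₁ ≫ h := hφ .unit
  have hk' : k' ≫ F.map e₂ = E.I.map e₂ ≫ k := hφ .counit
  have ha' : a' ≫ e₁ = a := (hφ .source).trans (Category.id_comp _)
  have hb' : b' ≫ e₂ = b := (hφ .target).trans (Category.id_comp _)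
  have hη {X Y : C} (g : X ⟶ Y) : η.app X ≫ F.map g = g ≫ η.app Y := (η.naturality g).symm
  have t₁ : (E.i0 _ ≫ h') ≫ F.map e₁ = (f' ≫ r') ≫ F.map e₁ := by
    rw [Category.assoc, Category.assoc, hh', hr', reassoc_of% hf', ← hh₀,
      ← E.i0_naturality_assoc]
  have t₂ : (E.i1 _ ≫ h') ≫ F.map e₁ = η.app _ ≫ F.map e₁ := by
    rw [Category.assoc, hh', hη, ← hh₁, ← E.i1_naturality_assoc]
  have t₃ : (E.i0 _ ≫ k') ≫ F.map e₂ = (r' ≫ F.map f') ≫ F.map e₂ := by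
    rw [Category.assoc, Category.assoc, hk', ← F.map_comp, hf', F.map_comp, reassoc_of% hr',
      ← hk₀, ← E.i0_naturality_assoc]
  have t₄ : (E.i1 _ ≫ k') ≫ F.map e₂ = η.app _ ≫ F.map e₂ := by
    rw [Category.assoc, hk', hη, ← hk₁, ← E.i1_naturality_assoc]
  have t₅ : (a' ≫ f') ≫ e₂ = (i ≫ b') ≫ e₂ := by
    rw [Category.assoc, Category.assoc, hf', hb', reassoc_of% ha', sq]
  have hfw : IsWeakEq E An f' :=
    (isWeakEq_iff_exists_homotopy hE hAn (fun X => (hF X).1) (fun X => (hF X).2) f').2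
      ⟨r', E.homotopy_iff.2 ⟨h', inj .map .inv _ _ t₁, inj .map .inv _ _ t₂⟩,
        E.homotopy_iff.2 ⟨k', inj .inv .counit _ _ t₃, inj .inv .counit _ _ t₄⟩⟩
  exact ⟨⟨z, f', hfw⟩, a', b', e₁, e₂, inj .source .target _ _ t₅, hf', ha', hb'⟩

end SolutionSet

section TrivialCofibrations

variable {E : Cylinder C} {L R An : MorphismProperty C}

/-- A square from a morphism of `L` to a weak equivalence factors through a weak equivalence
in `L`. -/
lemma exists_trivialCofibration_of_square [HasColimits C] (hW : IsCofGenWFS L R)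
    (hE : IsExactCylinder E L) {A B X Y : C} {i : A ⟶ B} (hi : L i) {f : X ⟶ Y}
    (hf : IsWeakEq E An f) {a : A ⟶ X} {b : B ⟶ Y} (w : a ≫ f = i ≫ b) :
    ∃ (Z : C) (j : X ⟶ Z) (q : Z ⟶ Y) (b' : B ⟶ Z), L j ∧ IsWeakEq E An j ∧
      a ≫ j = i ≫ b' ∧ j ≫ q = f ∧ b' ≫ q = b := by
  obtain ⟨S, _, hS⟩ := hW.exists_generating_set
  rw [llp_eq] at hS
  obtain ⟨Z, c, q, hc, hq, hcq⟩ := hW.factorization (pushout.desc f b w)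
  rw [hW.rlp_eq] at hq
  have hj : (pushout.inl a i ≫ c) ≫ q = f := by
    rw [Category.assoc, hcq, pushout.inl_desc]
  refine ⟨Z, pushout.inl a i ≫ c, q, pushout.inr a i ≫ c, ?_, ?_, ?_, hj, ?_⟩
  · subst hS
    exact MorphismProperty.comp_mem _ _ _ (MorphismProperty.pushout_inl _ _ hi) hc
  · exact (isWeakEq_of_rlp hE hW.initial_mem hq).of_comp_right (by rwa [hj])
  · rw [pushout.condition_assoc]
  · rw [Category.assoc, hcq, pushout.inr_desc]

/-- There is a small set of trivial cofibrations detecting trivial fibrations among weak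
equivalences. -/
lemma exists_small_set_trivialCofibrations [LocallyPresentable C] (hW : IsCofGenWFS L R)
    (hE : IsExactCylinder E L) (hAn : IsRightAnodyneClass E L An) :
    ∃ J : Set (Arrow C), Small.{v} J ∧
      (∀ ⦃A B : C⦄ (i : A ⟶ B), ofArrows J i → L i ∧ IsWeakEq E An i) ∧
      ∀ ⦃X Y : C⦄ (p : X ⟶ Y), IsWeakEq E An p → rlp (ofArrows J) p → rlp L p := by
  obtain ⟨S, _, hS⟩ := hW.exists_generating_set
  have hSL (s : S) : L s.1.hom := by
    rw [hS]
    exact fun _ _ g hg => hg _ s.2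
  choose K w hw hK using fun s : S => exists_solution_set hE hAn s.1.hom
  let T : Type v := Σ (s : Shrink.{v} S) (k : K ((equivShrink S).symm s)),
    { g : (((equivShrink S).symm s).1.left ⟶ (w _ k).left) ×
        (((equivShrink S).symm s).1.right ⟶ (w _ k).right) //
      g.1 ≫ (w _ k).hom = ((equivShrink S).symm s).1.hom ≫ g.2 }
  choose Z j q b hjL hjW h₁ h₂ h₃ using fun t : T =>
    exists_trivialCofibration_of_square hW hE (hSL _) (hw _ t.2.1) t.2.2.2
  refine ⟨Set.range fun t => Arrow.mk (j t), inferInstance, ?_, fun X Y p hp hJ => ?_⟩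
  · rintro A B i ⟨t, ht⟩
    have key : L (Arrow.mk i).hom ∧ IsWeakEq E An (Arrow.mk i).hom := ht ▸ ⟨hjL t, hjW t⟩
    exact key
  · suffices rlp (ofArrows S) p by
      intro A B i hi
      rw [hS] at hi
      exact hi p this
    intro A B i hi
    have key (s : S) : HasLiftingProperty s.1.hom p := by
      obtain ⟨s, rfl⟩ := (equivShrink S).symm.surjective s
      refine hasLiftingProperty_of_exists_lift fun x y sq => ?_
      obtain ⟨k, a', b', e₁, e₂, t₁, t₂, t₃, t₄⟩ := hK _ p x y hp sq
      let t : T := ⟨s, k, (a', b'), t₁⟩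
      have h₁' : a' ≫ j t = _ ≫ b t := h₁ t
      have h₂' : j t ≫ q t = (w _ k).hom := h₂ t
      have h₃' : b t ≫ q t = b' := h₃ t
      obtain ⟨l, hl, hl'⟩ := exists_lift_of_hasLiftingProperty (hJ (j t) ⟨t, rfl⟩) e₁
        (q t ≫ e₂) (by rw [reassoc_of% h₂', t₂])
      exact ⟨b t ≫ l, by rw [← reassoc_of% h₁', hl, t₃], by
        rw [Category.assoc, hl', reassoc_of% h₃', t₄]⟩
    exact key ⟨Arrow.mk i, hi⟩

lemma exists_factorization_trivialCofibration [LocallyPresentable C] (hW : IsCofGenWFS L R)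
    (hE : IsExactCylinder E L) (hAn : IsRightAnodyneClass E L An)
    (hfac : ∀ ⦃X Y : C⦄ (f : X ⟶ Y), ∃ (Z : C) (i : X ⟶ Z) (p : Z ⟶ Y),
      An i ∧ IsFib An p ∧ i ≫ p = f)
    (hrep : ∀ X : C, ∃ (X' : C) (i : X ⟶ X'), An i ∧ IsFibrantObj An X')
    {X Y : C} (f : X ⟶ Y) :
    ∃ (Z : C) (i : X ⟶ Z) (p : Z ⟶ Y), (L i ∧ IsWeakEq E An i) ∧
      rlp (fun _ _ f => L f ∧ IsWeakEq E An f) p ∧ i ≫ p = f := by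
  obtain ⟨S, _, hS⟩ := hW.exists_generating_set
  obtain ⟨J, _, hJ, hJ'⟩ := exists_small_set_trivialCofibrations hW hE hAn
  have lift {A B : C} {i : A ⟶ B} (hi : L i) :=
    isWeakEq_iff_forall_hasLiftingProperty hE hAn hW.initial_mem hfac hrep hi
  have hcell {A B : C} {i : A ⟶ B} (hi : llp (rlp (ofArrows J)) i) : L i ∧ IsWeakEq E An i := by
    have hiL : L i := by
      rw [hS]
      intro _ _ g hg
      refine hi g fun _ _ j hj => ?_
      have := (hJ j hj).1
      rw [hS] at this
      exact this g hg
    exact ⟨hiL, (lift hiL).2 fun _ _ p hX hY hp => hi p fun _ _ j hj =>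
      (lift (hJ j hj).1).1 (hJ j hj).2 p hX hY hp⟩
  obtain ⟨Z, i, p, hi, hp, w⟩ := exists_factorization_of_small J f
  refine ⟨Z, i, p, hcell hi, fun A B g hg => ?_, w⟩
  obtain ⟨_, c, q, hc, hq, hcq⟩ := exists_factorization_of_small J g
  have hq' : IsWeakEq E An q := (hcell hc).2.of_comp_left (by rw [hcq]; exact hg.2)
  exact (isRetractOf_left_factor hcq (hJ' q hq' hq g hg.1)).hasLiftingProperty_left (hc p hp)

end TrivialCofibrations

/-- Theorem 2.14 (righthm): the Contravariant model structure associated to a right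
homotopical structure. -/
theorem statement_0    {C : Type u} [Category.{v} C] [LocallyPresentable C]
    (L R : MorphismProperty C) (hW : IsCofGenWFS L R)
    (E : Cylinder C) (hE : IsExactCylinder E L)
    (An : MorphismProperty C) (hAn : IsRightAnodyneClass E L An) :
    ∃ M : ModelStructure C,
      M.cof = L ∧
      (∀ ⦃A B : C⦄ (f : A ⟶ B), M.weq f ↔ IsWeakEq E An f) ∧
      (∀ W : C, M.Fibrant W ↔ IsFibrantObj An W) ∧
      (∀ ⦃X Y : C⦄ (p : X ⟶ Y), IsFibrantObj An X → IsFibrantObj An Y →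
        (M.fib p ↔ IsFib An p)) ∧
      (∀ M' : ModelStructure C, M'.cof = L →
        (∀ ⦃A B : C⦄ (f : A ⟶ B), M'.weq f ↔ IsWeakEq E An f) → M' = M) := by
  obtain ⟨Λ, _, -, hΛ⟩ := hAn.exists_generating_set
  have hfac ⦃X Y : C⦄ (f : X ⟶ Y) : ∃ (Z : C) (i : X ⟶ Z) (p : Z ⟶ Y),
      An i ∧ IsFib An p ∧ i ≫ p = f := by
    obtain ⟨Z, i, p, hi, hp, w⟩ := exists_factorization_of_small Λ f
    subst hΛ
    exact ⟨Z, i, p, hi, fun _ _ j hj => hj p hp, w⟩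
  obtain ⟨F, η, _, _, -, hF⟩ := exists_accessible_fibrant_replacement Λ
  rw [← hΛ] at hF
  have hrep (X : C) : ∃ (X' : C) (i : X ⟶ X'), An i ∧ IsFibrantObj An X' :=
    ⟨F.obj X, η.app X, hF X⟩
  exact exists_modelStructure hW hE hAn hfac hrep fun _ _ f =>
    exists_factorization_trivialCofibration hW hE hAn hfac hrep f

end Paper
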